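/- The bilinear form ⟪·,·⟫ on Â satisfies: (i) it is symmetric and non-degenerate; (ii) for x = ∏_{k∈[a,b]} x_k and y = ∏_{k∈[a,b]} y_k (ordered products with k decreasing from left to right) with x_k, y_k ∈ Â[k], one has ⟪x,y⟫ = ∏_{k∈[a,b]} ⟪x_k, y_k⟫; (iii) for any x, y ∈ A_q(n) and m ∈ Z, one has (x,y)_A = ⟪φ_m(x), φ_m(y)⟫. -/

import Mathlib

/- Common setting: a symmetrizable generalized Cartan matrix, the field
`𝕂 = ℚ(q^{1/2})` (with `sqv = q^{1/2}` and `q = qh = sqv²`), quantum integers, the bosonic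
extension `hA A` presented by the `q`-Serre relations and the bosonic commutation
relations, its weight spaces and distinguished subalgebras, and the root-lattice
pairing. -/

set_option maxHeartbeats 1000000
set_option synthInstance.maxHeartbeats 400000

noncomputable section

structure GCM (I : Type) where
  c : I → I → ℤ
  d : I → ℤ
  d_pos : ∀ i, 0 < d i
  diag : ∀ i, c i i = 2
  offdiag : ∀ i j, i ≠ j → c i j ≤ 0
  dsymm : ∀ i j, d i * c i j = d j * c j i

abbrev 𝕂 : Type := RatFunc ℚ

/-- The square root `q^{1/2}` of `q`. -/
def sqv : 𝕂 := RatFunc.X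

/-- The indeterminate `q = (q^{1/2})²`. -/
def qh : 𝕂 := sqv ^ 2

def qNum (t : 𝕂) (n : ℕ) : 𝕂 := (t ^ n - t⁻¹ ^ n) / (t - t⁻¹)

def qFact (t : 𝕂) (n : ℕ) : 𝕂 := ∏ k ∈ Finset.range n, qNum t (k + 1)

def qBinom (t : 𝕂) (m k : ℕ) : 𝕂 := qFact t m / (qFact t k * qFact t (m - k))

variable {I : Type} [DecidableEq I]

/-- `q_i = q^{d_i}`. -/
def qd (A : GCM I) (i : I) : 𝕂 := qh ^ A.d i

/-- `ζ_i = 1 - q_i²`. -/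
def zi (A : GCM I) (i : I) : 𝕂 := 1 - qd A i ^ 2

/-- The `q`-Serre element `Σ_{k=0}^{b_{ij}} (-1)^k [b_{ij} choose k]_{q_i} a^k b a^{b_{ij}-k}`
for elements `a, b` of any `𝕂`-algebra, where `b_{ij} = 1 - c_{ij}`. -/
def serreIn {R : Type} [Ring R] [Algebra 𝕂 R] (A : GCM I) (i j : I) (a b : R) : R :=
  ∑ k ∈ Finset.range ((1 - A.c i j).toNat + 1),
    ((-1 : 𝕂) ^ k * qBinom (qd A i) ((1 - A.c i j).toNat) k) •
      (a ^ k * b * a ^ ((1 - A.c i j).toNat - k))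

/-- The defining relations of the bosonic extension: (a) for each `p`, the `q`-Serre
relations among the `f_{i,p}`; (b) for `m < p`,
`f_{i,m} f_{j,p} = q^{(-1)^{p-m+1}(α_i,α_j)} f_{j,p} f_{i,m} + δ_{(j,p),(i,m+1)}(1-q_i²)`. -/
inductive hARel (A : GCM I) : FreeAlgebra 𝕂 (I × ℤ) → FreeAlgebra 𝕂 (I × ℤ) → Prop
  | serre (i j : I) (p : ℤ) (h : i ≠ j) :
      hARel A (serreIn A i j (FreeAlgebra.ι 𝕂 (i, p)) (FreeAlgebra.ι 𝕂 (j, p))) 0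
  | comm (i j : I) (m p : ℤ) (h : m < p) :
      hARel A (FreeAlgebra.ι 𝕂 (i, m) * FreeAlgebra.ι 𝕂 (j, p))
        (qh ^ (((p - m + 1).negOnePow : ℤ) * (A.d i * A.c i j)) •
            (FreeAlgebra.ι 𝕂 (j, p) * FreeAlgebra.ι 𝕂 (i, m))
          + if j = i ∧ p = m + 1 then ((1 : 𝕂) - qd A i ^ 2) • 1 else 0)

/-- The bosonic extension `Â` associated with the generalized Cartan matrix. -/
abbrev hA (A : GCM I) : Type := RingQuot (hARel A)

/-- The generator `f_{i,p}` of the bosonic extension. -/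
def ff (A : GCM I) (i : I) (p : ℤ) : hA A :=
  RingQuot.mkAlgHom 𝕂 (hARel A) (FreeAlgebra.ι 𝕂 (i, p))

/-- The symmetric bilinear pairing on the root lattice, `(α_i, α_j) = d_i c_{ij}`. -/
def ip (A : GCM I) (β γ : I →₀ ℤ) : ℤ :=
  β.sum fun i a => γ.sum fun j b => a * b * (A.d i * A.c i j)

/-- `α_{i,m} = (-1)^m α_i` as an element of the root lattice. -/
def aim (i : I) (m : ℤ) : I →₀ ℤ := Finsupp.single i ((m.negOnePow : ℤ))

/-- The weight space of weight `β` of `Â`, where `wt (f_{i,p}) = (-1)^{p+1} α_i`. -/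
def hAwt (A : GCM I) (β : I →₀ ℤ) : Submodule 𝕂 (hA A) :=
  Submodule.span 𝕂 {x | ∃ l : List (I × ℤ),
    (l.map fun p => Finsupp.single p.1 (((p.2 + 1).negOnePow : ℤ))).sum = β ∧
    x = (l.map fun p => ff A p.1 p.2).prod}

/-- The subalgebra `Â[a,b]` generated by `{f_{i,k} | a ≤ k ≤ b}`. -/
def hAband (A : GCM I) (a b : ℤ) : Subalgebra 𝕂 (hA A) :=
  Algebra.adjoin 𝕂 {x | ∃ i k, a ≤ k ∧ k ≤ b ∧ x = ff A i k}

/-- The subalgebra `Â[m]`. -/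
def hAk (A : GCM I) (m : ℤ) : Subalgebra 𝕂 (hA A) := hAband A m m

/-- The subalgebra `Â_{≥ m}`. -/
def hAge (A : GCM I) (m : ℤ) : Subalgebra 𝕂 (hA A) :=
  Algebra.adjoin 𝕂 {x | ∃ i k, m ≤ k ∧ x = ff A i k}

/-- The subalgebra `Â_{≤ m}`. -/
def hAle (A : GCM I) (m : ℤ) : Subalgebra 𝕂 (hA A) :=
  Algebra.adjoin 𝕂 {x | ∃ i k, k ≤ m ∧ x = ff A i k}

/-- The subalgebra `Â_{> m}`. -/
def hAgt (A : GCM I) (m : ℤ) : Subalgebra 𝕂 (hA A) := hAge A (m + 1)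

/-- The subalgebra `Â_{< m}`. -/
def hAlt (A : GCM I) (m : ℤ) : Subalgebra 𝕂 (hA A) := hAle A (m - 1)

/-- The `q`-Serre relations for `U_q^-(g)` (with scalars extended to `ℚ(q^{1/2})`). -/
inductive URel (A : GCM I) : FreeAlgebra 𝕂 I → FreeAlgebra 𝕂 I → Prop
  | serre (i j : I) (h : i ≠ j) :
      URel A (serreIn A i j (FreeAlgebra.ι 𝕂 i) (FreeAlgebra.ι 𝕂 j)) 0

/-- `ℚ(q^{1/2}) ⊗_{ℚ(q)} U_q^-(g)`. -/
abbrev Uq (A : GCM I) : Type := RingQuot (URel A)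

/-- The generator `f_i` of `U_q^-(g)`. -/
def fg (A : GCM I) (i : I) : Uq A :=
  RingQuot.mkAlgHom 𝕂 (URel A) (FreeAlgebra.ι 𝕂 i)

/-- The weight space of weight `β` of `U_q^-(g)`, where `wt (f_i) = -α_i`. -/
def Uwt (A : GCM I) (β : I →₀ ℤ) : Submodule 𝕂 (Uq A) :=
  Submodule.span 𝕂 {x | ∃ l : List I,
    -((l.map fun i => Finsupp.single i (1 : ℤ)).sum) = β ∧ x = (l.map (fg A)).prod}

open scoped TensorProduct

/-- The pairing on `U ⊗ U` induced by two functionals. -/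
def pairT (A : GCM I) (f g : Uq A →ₗ[𝕂] 𝕂) : Uq A ⊗[𝕂] Uq A →ₗ[𝕂] 𝕂 :=
  TensorProduct.lift ((LinearMap.mul 𝕂 𝕂).compl₁₂ f g)

set_option linter.unusedSectionVars false

/-! ### Scalars -/

lemma sqv_ne_zero : sqv ≠ 0 := RatFunc.X_ne_zero

lemma qh_ne_zero : qh ≠ 0 := pow_ne_zero 2 sqv_ne_zero

lemma sqv_pow_ne_one {n : ℕ} (hn : n ≠ 0) : sqv ^ n ≠ 1 := by
  intro h
  have h1 : algebraMap (Polynomial ℚ) 𝕂 (Polynomial.X ^ n) = algebraMap (Polynomial ℚ) 𝕂 1 := by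
    rw [map_pow, map_one, RatFunc.algebraMap_X]
    exact h
  have h2 := RatFunc.algebraMap_injective ℚ h1
  have h3 := congrArg Polynomial.natDegree h2
  rw [Polynomial.natDegree_X_pow, Polynomial.natDegree_one] at h3
  exact hn h3

lemma sqv_zpow_eq_one {n : ℤ} (h : sqv ^ n = 1) : n = 0 := by
  by_contra hn
  have h0 : n.natAbs ≠ 0 := by omega
  apply sqv_pow_ne_one h0
  rcases Int.natAbs_eq n with h' | h'
  · rw [h', zpow_natCast] at h
    exact h
  · rw [h', zpow_neg, inv_eq_one, zpow_natCast] at h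
    exact h

lemma qh_zpow (n : ℤ) : qh ^ n = sqv ^ (2 * n) := by
  rw [zpow_mul]
  rfl

lemma qh_zpow_eq_one {n : ℤ} (h : qh ^ n = 1) : n = 0 := by
  rw [qh_zpow] at h
  have := sqv_zpow_eq_one h
  omega

lemma qd_pow (A : GCM I) (i : I) (n : ℕ) : qd A i ^ n = qh ^ (A.d i * n) := by
  rw [qd, zpow_mul, zpow_natCast]

lemma zi_ne_zero (A : GCM I) (i : I) : (1 : 𝕂) - qd A i ^ 2 ≠ 0 := by
  intro h
  rw [qd_pow] at h
  have := qh_zpow_eq_one (sub_eq_zero.mp h).symm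
  have := A.d_pos i
  push_cast at *
  omega

lemma qNum_ne_zero (A : GCM I) (i : I) {n : ℕ} (hn : n ≠ 0) : qNum (qd A i) n ≠ 0 := by
  have hd := A.d_pos i
  have key : ∀ n : ℕ, n ≠ 0 → qd A i ^ n - (qd A i)⁻¹ ^ n ≠ 0 := by
    intro n hn h
    have h1 : qd A i ^ n = (qd A i ^ n)⁻¹ := by
      rw [← inv_pow]; exact sub_eq_zero.mp h
    rw [qd_pow, ← zpow_neg] at h1
    have h2 : qh ^ (A.d i * n + A.d i * n) = 1 := by
      rw [zpow_add₀ qh_ne_zero]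
      nth_rw 2 [h1]
      rw [← zpow_add₀ qh_ne_zero, add_neg_cancel, zpow_zero]
    have h3 := qh_zpow_eq_one h2
    have h4 : A.d i * (n : ℤ) = 0 := by omega
    rcases mul_eq_zero.mp h4 with h5 | h5 <;> omega
  refine div_ne_zero (key n hn) ?_
  simpa using key 1 one_ne_zero

lemma qFact_ne_zero (A : GCM I) (i : I) (n : ℕ) : qFact (qd A i) n ≠ 0 :=
  Finset.prod_ne_zero_iff.mpr fun _ _ => qNum_ne_zero A i (Nat.succ_ne_zero _)

lemma qBinom_self (A : GCM I) (i : I) (n : ℕ) : qBinom (qd A i) n n = 1 := by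
  have h : qFact (qd A i) 0 = 1 := rfl
  rw [qBinom, Nat.sub_self, h, mul_one, div_self (qFact_ne_zero A i n)]

/-! ### The pairing on the root lattice -/

/-- The simple root `α_i`. -/
def simpleRoot (i : I) : I →₀ ℤ := Finsupp.single i 1

lemma ip_zero_left (A : GCM I) (γ : I →₀ ℤ) : ip A 0 γ = 0 := Finsupp.sum_zero_index

lemma ip_add_left (A : GCM I) (β β' γ : I →₀ ℤ) :
    ip A (β + β') γ = ip A β γ + ip A β' γ := by
  unfold ip
  apply Finsupp.sum_add_index'
  · intro i
    simp
  · intro i a b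
    rw [← Finsupp.sum_add]
    refine Finsupp.sum_congr fun j _ => ?_
    ring

lemma ip_symm (A : GCM I) (β γ : I →₀ ℤ) : ip A β γ = ip A γ β := by
  unfold ip
  rw [Finsupp.sum_comm]
  refine Finsupp.sum_congr fun j _ => Finsupp.sum_congr fun i _ => ?_
  rw [A.dsymm i j]
  ring

lemma ip_zero_right (A : GCM I) (γ : I →₀ ℤ) : ip A γ 0 = 0 := by
  rw [ip_symm, ip_zero_left]

lemma ip_add_right (A : GCM I) (β γ γ' : I →₀ ℤ) :
    ip A β (γ + γ') = ip A β γ + ip A β γ' := by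
  rw [ip_symm, ip_add_left, ip_symm A γ, ip_symm A γ']

lemma ip_smul_left (A : GCM I) (n : ℤ) (β γ : I →₀ ℤ) : ip A (n • β) γ = n * ip A β γ :=
  map_zsmul (AddMonoidHom.mk' (fun β => ip A β γ) fun _ _ => ip_add_left A _ _ γ) n β

lemma ip_smul_right (A : GCM I) (n : ℤ) (β γ : I →₀ ℤ) : ip A β (n • γ) = n * ip A β γ := by
  rw [ip_symm, ip_smul_left, ip_symm]

lemma ip_neg_left (A : GCM I) (β γ : I →₀ ℤ) : ip A (-β) γ = -ip A β γ := by
  simpa using ip_smul_left A (-1) β γ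

lemma ip_neg_right (A : GCM I) (β γ : I →₀ ℤ) : ip A β (-γ) = -ip A β γ := by
  simpa using ip_smul_right A (-1) β γ

lemma ip_sub_left (A : GCM I) (β β' γ : I →₀ ℤ) :
    ip A (β - β') γ = ip A β γ - ip A β' γ := by
  rw [sub_eq_add_neg, ip_add_left, ip_neg_left, ← sub_eq_add_neg]

lemma ip_sub_right (A : GCM I) (β γ γ' : I →₀ ℤ) :
    ip A β (γ - γ') = ip A β γ - ip A β γ' := by
  rw [sub_eq_add_neg, ip_add_right, ip_neg_right, ← sub_eq_add_neg]

lemma ip_simpleRoot (A : GCM I) (i j : I) :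
    ip A (simpleRoot i) (simpleRoot j) = A.d i * A.c i j := by
  simp [ip, simpleRoot]

lemma ip_simpleRoot_self (A : GCM I) (i : I) :
    ip A (simpleRoot i) (simpleRoot i) = 2 * A.d i := by
  rw [ip_simpleRoot, A.diag, mul_comm]

lemma ip_eq_sum (A : GCM I) (β γ : I →₀ ℤ) :
    ip A β γ = β.sum fun i a => a * ip A (simpleRoot i) γ := by
  unfold ip
  refine Finsupp.sum_congr fun i _ => ?_
  rw [simpleRoot, Finsupp.sum_single_index (by simp), Finsupp.mul_sum]
  refine Finsupp.sum_congr fun j _ => ?_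
  ring

/-- The pairing `(ρ, β) = Σ_i d_i β_i`. -/
def rhoPair (A : GCM I) (β : I →₀ ℤ) : ℤ := β.sum fun i a => A.d i * a

lemma rhoPair_add (A : GCM I) (β γ : I →₀ ℤ) :
    rhoPair A (β + γ) = rhoPair A β + rhoPair A γ :=
  Finsupp.sum_add_index' (by simp) (by intros; ring)

lemma rhoPair_simpleRoot (A : GCM I) (i : I) : rhoPair A (simpleRoot i) = A.d i := by
  simp [rhoPair, simpleRoot]

/-- The height `Σ_i β_i`. -/
def height (β : I →₀ ℤ) : ℤ := β.sum fun _ a => a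

lemma height_add (β γ : I →₀ ℤ) : height (β + γ) = height β + height γ :=
  Finsupp.sum_add_index' (by simp) (by intros; ring)

lemma height_simpleRoot (i : I) : height (simpleRoot i) = 1 := by
  simp [height, simpleRoot]

lemma height_zero : height (0 : I →₀ ℤ) = 0 := Finsupp.sum_zero_index

lemma height_sub (β γ : I →₀ ℤ) : height (β - γ) = height β - height γ := by
  have := height_add (β - γ) γ
  rw [sub_add_cancel] at this
  omega

/-! ### The space of words -/

/-- The vector space spanned by the words in the letters `I`. -/
abbrev WordSpace (I : Type) : Type := List I →₀ 𝕂

/-- A word as a vector. -/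
def sg (w : List I) : WordSpace I := Finsupp.single w 1

/-- The linear map with prescribed values on words. -/
def onWords {V : Type} [AddCommMonoid V] [Module 𝕂 V] (f : List I → V) : WordSpace I →ₗ[𝕂] V :=
  Finsupp.linearCombination 𝕂 f

lemma onWords_sg {V : Type} [AddCommMonoid V] [Module 𝕂 V] (f : List I → V) (w : List I) :
    onWords f (sg w) = f w := by
  simp [onWords, sg]

lemma word_ext {V : Type} [AddCommMonoid V] [Module 𝕂 V] {f g : WordSpace I →ₗ[𝕂] V}
    (h : ∀ w, f (sg w) = g (sg w)) : f = g :=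
  Finsupp.lhom_ext' fun w => LinearMap.ext_ring (h w)

lemma word_ext_apply {V : Type} [AddCommMonoid V] [Module 𝕂 V] (f g : WordSpace I →ₗ[𝕂] V)
    (h : ∀ w, f (sg w) = g (sg w)) (x : WordSpace I) : f x = g x := by
  rw [word_ext h]

lemma word_induction {P : WordSpace I → Prop} (h0 : P 0)
    (hadd : ∀ x y, P x → P y → P (x + y)) (hsmul : ∀ (c : 𝕂) (x), P x → P (c • x))
    (hw : ∀ w, P (sg w)) (x : WordSpace I) : P x := by
  induction x using Finsupp.induction_linear with
  | zero => exact h0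
  | add f g hf hg => exact hadd f g hf hg
  | single w c =>
    have : (Finsupp.single w c : WordSpace I) = c • sg w := by simp [sg]
    rw [this]
    exact hsmul c _ (hw w)

/-- The (positive) weight of a word. -/
def wordWt (w : List I) : I →₀ ℤ := (w.map simpleRoot).sum

lemma wordWt_nil : wordWt ([] : List I) = 0 := rfl

lemma wordWt_cons (j : I) (w : List I) : wordWt (j :: w) = simpleRoot j + wordWt w := by
  simp [wordWt]

lemma wordWt_append (v w : List I) : wordWt (v ++ w) = wordWt v + wordWt w := by
  simp [wordWt]

lemma wordWt_reverse (w : List I) : wordWt w.reverse = wordWt w := by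
  simp [wordWt, List.sum_reverse]

lemma wordWt_apply (w : List I) (i : I) : wordWt w i = w.count i := by
  induction w with
  | nil => simp [wordWt]
  | cons j w ih =>
    rw [wordWt_cons, Finsupp.add_apply, ih, List.count_cons, simpleRoot, Finsupp.single_apply]
    by_cases h : j = i
    · simp [h, add_comm]
    · simp [h]

lemma height_wordWt (w : List I) : height (wordWt w) = w.length := by
  induction w with
  | nil => exact height_zero
  | cons j w ih =>
    rw [wordWt_cons, height_add, ih, height_simpleRoot]
    push_cast [List.length_cons]
    ring

lemma perm_of_wordWt_eq {v w : List I} (h : wordWt v = wordWt w) : v.Perm w := by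
  rw [List.perm_iff_count]
  intro i
  have := DFunLike.congr_fun h i
  rw [wordWt_apply, wordWt_apply] at this
  exact_mod_cast this

/-- Left multiplication by the letter `j`. -/
def lmulW (j : I) : WordSpace I →ₗ[𝕂] WordSpace I := onWords fun w => sg (j :: w)

/-- Right multiplication by the letter `j`. -/
def rmulW (j : I) : WordSpace I →ₗ[𝕂] WordSpace I := onWords fun w => sg (w ++ [j])

/-- The operator acting by the scalar `g β` on words of weight `β`. -/
def scaleW (g : (I →₀ ℤ) → 𝕂) : WordSpace I →ₗ[𝕂] WordSpace I :=
  onWords fun w => g (wordWt w) • sg w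

/-- Reversal of words. -/
def revW : WordSpace I →ₗ[𝕂] WordSpace I := onWords fun w => sg w.reverse

/-- The coefficient of the empty word. -/
def counitW : WordSpace I →ₗ[𝕂] 𝕂 := Finsupp.lapply []

lemma lmulW_sg (j : I) (w : List I) : lmulW j (sg w) = sg (j :: w) := onWords_sg _ _

lemma rmulW_sg (j : I) (w : List I) : rmulW j (sg w) = sg (w ++ [j]) := onWords_sg _ _

lemma scaleW_sg (g : (I →₀ ℤ) → 𝕂) (w : List I) : scaleW g (sg w) = g (wordWt w) • sg w :=
  onWords_sg _ _

lemma revW_sg (w : List I) : revW (sg w) = sg w.reverse := onWords_sg _ _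

lemma counitW_nil : counitW (sg ([] : List I)) = 1 := by simp [counitW, sg]

lemma counitW_cons (j : I) (w : List I) : counitW (sg (j :: w)) = 0 := by simp [counitW, sg]

lemma counitW_lmulW (j : I) (x : WordSpace I) : counitW (lmulW j x) = 0 := by
  refine word_ext_apply (counitW ∘ₗ lmulW j) 0 (fun w => ?_) x
  simp [lmulW_sg, counitW_cons]

lemma counitW_revW (x : WordSpace I) : counitW (revW x) = counitW x := by
  refine word_ext_apply (counitW ∘ₗ revW) counitW (fun w => ?_) x
  rw [LinearMap.comp_apply, revW_sg]
  simp [counitW, sg, Finsupp.single_apply]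

lemma revW_revW (x : WordSpace I) : revW (revW x) = x := by
  refine word_ext_apply (revW ∘ₗ revW) LinearMap.id (fun w => ?_) x
  simp [revW_sg]

lemma revW_lmulW (j : I) (x : WordSpace I) : revW (lmulW j x) = rmulW j (revW x) := by
  refine word_ext_apply (revW ∘ₗ lmulW j) (rmulW j ∘ₗ revW) (fun w => ?_) x
  simp [revW_sg, lmulW_sg, rmulW_sg]

lemma lmulW_rmulW (i j : I) (x : WordSpace I) : lmulW i (rmulW j x) = rmulW j (lmulW i x) := by
  refine word_ext_apply (lmulW i ∘ₗ rmulW j) (rmulW j ∘ₗ lmulW i) (fun w => ?_) x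
  simp [lmulW_sg, rmulW_sg]

lemma scaleW_lmulW (g : (I →₀ ℤ) → 𝕂) (j : I) (x : WordSpace I) :
    scaleW g (lmulW j x) = lmulW j (scaleW (fun β => g (simpleRoot j + β)) x) := by
  refine word_ext_apply (scaleW g ∘ₗ lmulW j) (lmulW j ∘ₗ scaleW _) (fun w => ?_) x
  simp [lmulW_sg, scaleW_sg, wordWt_cons]

lemma scaleW_rmulW (g : (I →₀ ℤ) → 𝕂) (j : I) (x : WordSpace I) :
    scaleW g (rmulW j x) = rmulW j (scaleW (fun β => g (simpleRoot j + β)) x) := by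
  refine word_ext_apply (scaleW g ∘ₗ rmulW j) (rmulW j ∘ₗ scaleW _) (fun w => ?_) x
  simp [rmulW_sg, scaleW_sg, wordWt_append, wordWt_cons, wordWt_nil, add_comm]

lemma scaleW_revW (g : (I →₀ ℤ) → 𝕂) (x : WordSpace I) :
    scaleW g (revW x) = revW (scaleW g x) := by
  refine word_ext_apply (scaleW g ∘ₗ revW) (revW ∘ₗ scaleW g) (fun w => ?_) x
  simp [revW_sg, scaleW_sg, wordWt_reverse]

lemma scaleW_scaleW (g h : (I →₀ ℤ) → 𝕂) (x : WordSpace I) :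
    scaleW g (scaleW h x) = scaleW (fun β => g β * h β) x := by
  refine word_ext_apply (scaleW g ∘ₗ scaleW h) (scaleW _) (fun w => ?_) x
  simp [scaleW_sg, smul_smul, mul_comm]

lemma scaleW_const (c : 𝕂) (x : WordSpace I) : scaleW (fun _ => c) x = c • x := by
  refine word_ext_apply (scaleW _) (c • LinearMap.id) (fun w => ?_) x
  simp [scaleW_sg]

lemma scaleW_smul (c : 𝕂) (g : (I →₀ ℤ) → 𝕂) (x : WordSpace I) :
    scaleW (fun β => c * g β) x = c • scaleW g x := by
  rw [← scaleW_const c (scaleW g x), scaleW_scaleW]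

/-! ### Skew derivations and the pairing of words -/

/-- The value of the left skew derivation on a word. -/
def lderWord (A : GCM I) (i : I) : List I → WordSpace I
  | [] => 0
  | j :: z => (if i = j then sg z else 0) +
      qh ^ (-ip A (simpleRoot i) (simpleRoot j)) • lmulW j (lderWord A i z)

/-- The value of the right skew derivation on a word. -/
def rderWord (A : GCM I) (i : I) : List I → WordSpace I
  | [] => 0
  | j :: z => (if i = j then qh ^ (-ip A (simpleRoot i) (wordWt z)) • sg z else 0) +
      lmulW j (rderWord A i z)

/-- The left skew derivation `l_i(x y) = l_i(x) y + q^{-(α_i, |x|)} x l_i(y)`. -/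
def lder (A : GCM I) (i : I) : WordSpace I →ₗ[𝕂] WordSpace I := onWords (lderWord A i)

/-- The right skew derivation `r_i(x y) = q^{-(α_i, |y|)} r_i(x) y + x r_i(y)`. -/
def rder (A : GCM I) (i : I) : WordSpace I →ₗ[𝕂] WordSpace I := onWords (rderWord A i)

/-- The operator acting by `q^{(α_i, β)}` in weight `β`. -/
def torusW (A : GCM I) (i : I) : WordSpace I →ₗ[𝕂] WordSpace I :=
  scaleW fun β => qh ^ ip A (simpleRoot i) β

/-- The operator acting by `q^{-(α_i, β)}` in weight `β`. -/
def torusInvW (A : GCM I) (i : I) : WordSpace I →ₗ[𝕂] WordSpace I :=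
  scaleW fun β => qh ^ (-ip A (simpleRoot i) β)

lemma lder_nil (A : GCM I) (i : I) : lder A i (sg []) = 0 := onWords_sg _ _

lemma rder_nil (A : GCM I) (i : I) : rder A i (sg []) = 0 := onWords_sg _ _

lemma lder_lmulW (A : GCM I) (i j : I) (x : WordSpace I) :
    lder A i (lmulW j x) = (if i = j then x else 0) +
      qh ^ (-ip A (simpleRoot i) (simpleRoot j)) • lmulW j (lder A i x) := by
  refine word_ext_apply (lder A i ∘ₗ lmulW j) ((if i = j then LinearMap.id else 0) +
      qh ^ (-ip A (simpleRoot i) (simpleRoot j)) • lmulW j ∘ₗ lder A i) (fun w => ?_) x |>.trans ?_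
  · simp only [LinearMap.comp_apply, LinearMap.add_apply, LinearMap.smul_apply, lmulW_sg, lder,
      onWords_sg, lderWord]
    split_ifs <;> simp
  · split_ifs <;> simp

lemma rder_lmulW (A : GCM I) (i j : I) (x : WordSpace I) :
    rder A i (lmulW j x) = (if i = j then torusInvW A i x else 0) + lmulW j (rder A i x) := by
  refine word_ext_apply (rder A i ∘ₗ lmulW j) ((if i = j then torusInvW A i else 0) +
      lmulW j ∘ₗ rder A i) (fun w => ?_) x |>.trans ?_
  · simp only [LinearMap.comp_apply, LinearMap.add_apply, lmulW_sg, rder, onWords_sg, rderWord]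
    split_ifs <;> simp [torusInvW, scaleW_sg]
  · split_ifs <;> simp

lemma torusInvW_lmulW (A : GCM I) (i j : I) (x : WordSpace I) :
    torusInvW A i (lmulW j x) =
      qh ^ (-ip A (simpleRoot i) (simpleRoot j)) • lmulW j (torusInvW A i x) := by
  rw [torusInvW, scaleW_lmulW, ← map_smul, ← scaleW_smul]
  simp only [ip_add_right, neg_add, zpow_add₀ qh_ne_zero]

lemma torusInvW_rmulW (A : GCM I) (i j : I) (x : WordSpace I) :
    torusInvW A i (rmulW j x) =
      qh ^ (-ip A (simpleRoot i) (simpleRoot j)) • rmulW j (torusInvW A i x) := by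
  rw [torusInvW, scaleW_rmulW, ← map_smul, ← scaleW_smul]
  simp only [ip_add_right, neg_add, zpow_add₀ qh_ne_zero]

lemma torusW_lmulW (A : GCM I) (i j : I) (x : WordSpace I) :
    torusW A i (lmulW j x) =
      qh ^ (ip A (simpleRoot i) (simpleRoot j)) • lmulW j (torusW A i x) := by
  rw [torusW, scaleW_lmulW, ← map_smul, ← scaleW_smul]
  simp only [ip_add_right, zpow_add₀ qh_ne_zero]

lemma torusInvW_nil (A : GCM I) (i : I) : torusInvW A i (sg []) = sg [] := by
  simp [torusInvW, scaleW_sg, wordWt_nil, ip_zero_right]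

lemma torusW_nil (A : GCM I) (i : I) : torusW A i (sg []) = sg [] := by
  simp [torusW, scaleW_sg, wordWt_nil, ip_zero_right]

lemma torusInvW_torusW (A : GCM I) (i : I) (x : WordSpace I) :
    torusInvW A i (torusW A i x) = x := by
  rw [torusW, torusInvW, scaleW_scaleW]
  simp only [zpow_neg, inv_mul_cancel₀ (zpow_ne_zero _ qh_ne_zero), scaleW_const, one_smul]

lemma lder_rmulW (A : GCM I) (i j : I) (x : WordSpace I) :
    lder A i (rmulW j x) = (if i = j then torusInvW A i x else 0) + rmulW j (lder A i x) := by
  induction x using word_induction with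
  | h0 => simp
  | hadd x y hx hy =>
    simp only [map_add, hx, hy]
    split_ifs <;> abel
  | hsmul c x hx =>
    simp only [map_smul, hx, smul_add]
    split_ifs <;> simp
  | hw w =>
  induction w with
  | nil =>
    rw [rmulW_sg, List.nil_append, ← lmulW_sg, lder_lmulW, lder_nil, torusInvW_nil]
    simp
  | cons k w ih =>
    rw [← lmulW_sg, ← lmulW_rmulW, lder_lmulW, ih, lder_lmulW, torusInvW_lmulW]
    split_ifs <;> simp [lmulW_rmulW, ← add_assoc, add_comm]

lemma rder_rmulW (A : GCM I) (i j : I) (x : WordSpace I) :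
    rder A i (rmulW j x) = (if i = j then x else 0) +
      qh ^ (-ip A (simpleRoot i) (simpleRoot j)) • rmulW j (rder A i x) := by
  induction x using word_induction with
  | h0 => simp
  | hadd x y hx hy =>
    simp only [map_add, hx, hy, smul_add]
    split_ifs <;> abel
  | hsmul c x hx =>
    simp only [map_smul, hx, smul_add]
    split_ifs <;> simp [smul_comm c]
  | hw w =>
  induction w with
  | nil =>
    rw [rmulW_sg, List.nil_append, ← lmulW_sg, rder_lmulW, rder_nil, torusInvW_nil]
    simp
  | cons k w ih =>
    rw [← lmulW_sg, ← lmulW_rmulW, rder_lmulW, ih, rder_lmulW, torusInvW_rmulW]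
    split_ifs <;> simp [lmulW_rmulW, ← add_assoc, add_comm]

lemma scaleW_lder (A : GCM I) (i : I) (g : (I →₀ ℤ) → 𝕂) (x : WordSpace I) :
    scaleW g (lder A i x) = lder A i (scaleW (fun β => g (β - simpleRoot i)) x) := by
  refine word_ext_apply (scaleW g ∘ₗ lder A i) (lder A i ∘ₗ scaleW _) (fun w => ?_) x
  simp only [LinearMap.comp_apply]
  induction w generalizing g with
  | nil => simp [scaleW_sg, lder_nil]
  | cons k w ih =>
    rw [← lmulW_sg, lder_lmulW, scaleW_lmulW, lder_lmulW, map_add, map_smul, scaleW_lmulW, ih]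
    simp only [add_sub_assoc]
    congr 1
    split_ifs with h
    · subst h
      simp [scaleW_sg]
    · simp

lemma scaleW_rder (A : GCM I) (i : I) (g : (I →₀ ℤ) → 𝕂) (x : WordSpace I) :
    scaleW g (rder A i x) = rder A i (scaleW (fun β => g (β - simpleRoot i)) x) := by
  refine word_ext_apply (scaleW g ∘ₗ rder A i) (rder A i ∘ₗ scaleW _) (fun w => ?_) x
  simp only [LinearMap.comp_apply]
  induction w generalizing g with
  | nil => simp [scaleW_sg, rder_nil]
  | cons k w ih =>
    rw [← lmulW_sg, rder_lmulW, scaleW_lmulW, rder_lmulW, map_add, scaleW_lmulW, ih]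
    simp only [add_sub_assoc]
    congr 1
    split_ifs with h
    · subst h
      simp [scaleW_sg, torusInvW, smul_smul, mul_comm]
    · simp

lemma torusInvW_lder (A : GCM I) (i j : I) (x : WordSpace I) :
    torusInvW A j (lder A i x) =
      qh ^ (ip A (simpleRoot j) (simpleRoot i)) • lder A i (torusInvW A j x) := by
  rw [torusInvW, scaleW_lder, ← map_smul, ← scaleW_smul]
  congr 3
  funext β
  rw [← zpow_add₀ qh_ne_zero, ip_sub_right]
  congr 1
  ring

lemma rder_lder (A : GCM I) (i k : I) (x : WordSpace I) :
    rder A i (lder A k x) = lder A k (rder A i x) := by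
  refine word_ext_apply (rder A i ∘ₗ lder A k) (lder A k ∘ₗ rder A i) (fun w => ?_) x
  simp only [LinearMap.comp_apply]
  induction w with
  | nil => simp [rder_nil, lder_nil]
  | cons j w ih =>
    rw [← lmulW_sg, lder_lmulW, rder_lmulW, map_add, map_add, map_smul, rder_lmulW, lder_lmulW,
      ih]
    have h : lder A k (torusInvW A i (sg w)) =
        qh ^ (-ip A (simpleRoot i) (simpleRoot k)) • torusInvW A i (lder A k (sg w)) := by
      rw [torusInvW_lder, smul_smul, ← zpow_add₀ qh_ne_zero, neg_add_cancel, zpow_zero, one_smul]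
    by_cases h1 : i = j
    · by_cases h2 : k = j
      · subst h1 h2
        simp [h]
        abel
      · subst h1
        simp [h, h2, ip_symm A (simpleRoot k)]
    · by_cases h2 : k = j
      · simp [h1, h2]
      · simp [h1, h2]

lemma revW_lder (A : GCM I) (i : I) (x : WordSpace I) :
    revW (lder A i x) = rder A i (revW x) := by
  refine word_ext_apply (revW ∘ₗ lder A i) (rder A i ∘ₗ revW) (fun w => ?_) x
  simp only [LinearMap.comp_apply]
  induction w with
  | nil => simp [lder_nil, rder_nil, revW_sg]
  | cons j w ih =>
    rw [← lmulW_sg, lder_lmulW, revW_lmulW, rder_rmulW, map_add, map_smul, revW_lmulW, ih]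
    split_ifs <;> simp

/-- The pairing of a word with a vector, `⟨i w | x⟩ = ⟨w | l_i x⟩`. -/
def wordPair (A : GCM I) : List I → WordSpace I →ₗ[𝕂] 𝕂
  | [] => counitW
  | i :: w => wordPair A w ∘ₗ lder A i

lemma wordPair_nil (A : GCM I) (x : WordSpace I) : wordPair A [] x = counitW x := rfl

lemma wordPair_cons (A : GCM I) (i : I) (w : List I) (x : WordSpace I) :
    wordPair A (i :: w) x = wordPair A w (lder A i x) := rfl

lemma counitW_lder (A : GCM I) (i : I) (x : WordSpace I) :
    counitW (lder A i x) = counitW (rder A i x) := by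
  refine word_ext_apply (counitW ∘ₗ lder A i) (counitW ∘ₗ rder A i) (fun w => ?_) x
  cases w with
  | nil => simp [lder_nil, rder_nil]
  | cons j w =>
    simp only [LinearMap.comp_apply]
    rw [← lmulW_sg, lder_lmulW, rder_lmulW, map_add, map_add, map_smul, counitW_lmulW,
      counitW_lmulW]
    split_ifs with h
    · cases w with
      | nil => simp [torusInvW_nil]
      | cons k w => simp [torusInvW, scaleW_sg, counitW_cons]
    · simp

lemma wordPair_append (A : GCM I) (i : I) (w : List I) (x : WordSpace I) :
    wordPair A (w ++ [i]) x = wordPair A w (rder A i x) := by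
  induction w generalizing x with
  | nil => exact counitW_lder A i x
  | cons j w ih => rw [List.cons_append, wordPair_cons, wordPair_cons, ih, rder_lder]

lemma wordPair_scaleW (A : GCM I) (g : (I →₀ ℤ) → 𝕂) (w : List I) (x : WordSpace I) :
    wordPair A w (scaleW g x) = g (wordWt w) * wordPair A w x := by
  induction w generalizing g x with
  | nil =>
    refine word_ext_apply (counitW ∘ₗ scaleW g) (g (wordWt []) • counitW) (fun w => ?_) x
    cases w with
    | nil => simp [scaleW_sg]
    | cons k w => simp [scaleW_sg, counitW_cons]
  | cons i w ih =>
    have h := ih (fun β => g (simpleRoot i + β)) (lder A i x)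
    rw [scaleW_lder] at h
    simp only [add_sub_cancel] at h
    rw [wordPair_cons, wordPair_cons, h, wordWt_cons]

lemma wordPair_revW (A : GCM I) (w : List I) (x : WordSpace I) :
    wordPair A w.reverse (revW x) = wordPair A w x := by
  induction w generalizing x with
  | nil => exact counitW_revW x
  | cons i w ih =>
    rw [List.reverse_cons, wordPair_append, ← revW_lder, ih, wordPair_cons]

lemma wordPair_eq_zero (A : GCM I) {v w : List I} (h : wordWt v ≠ wordWt w) :
    wordPair A v (sg w) = 0 := by
  have h1 := wordPair_scaleW A (fun β => if β = wordWt w then 1 else 0) v (sg w)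
  simpa [scaleW_sg, h] using h1

/-- The bilinear extension of `wordPair`. -/
def vecPair (A : GCM I) : WordSpace I →ₗ[𝕂] WordSpace I →ₗ[𝕂] 𝕂 := onWords (wordPair A)

lemma vecPair_sg (A : GCM I) (w : List I) : vecPair A (sg w) = wordPair A w := onWords_sg _ _

lemma vecPair_rmulW (A : GCM I) (i : I) (x y : WordSpace I) :
    vecPair A (rmulW i x) y = vecPair A x (rder A i y) := by
  refine word_ext_apply ((vecPair A).flip y ∘ₗ rmulW i) ((vecPair A).flip (rder A i y))
    (fun w => ?_) x
  simp [rmulW_sg, vecPair_sg, wordPair_append]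

lemma vecPair_lder (A : GCM I) (i : I) (x y : WordSpace I) :
    vecPair A (lder A i x) y = vecPair A x (lmulW i y) := by
  refine word_ext_apply ((vecPair A).flip y ∘ₗ lder A i) ((vecPair A).flip (lmulW i y))
    (fun w => ?_) x
  simp only [LinearMap.comp_apply, LinearMap.flip_apply]
  induction w using List.reverseRecOn generalizing y with
  | nil => simp [lder_nil, vecPair_sg, wordPair_nil, counitW_lmulW]
  | append_singleton w k ih =>
    rw [← rmulW_sg, lder_rmulW, vecPair_rmulW, rder_lmulW, map_add, LinearMap.add_apply,
      vecPair_rmulW, ih, map_add]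
    congr 1
    by_cases h : i = k
    · subst h
      simp only [if_true]
      rw [vecPair_sg, torusInvW, scaleW_sg, map_smul, wordPair_scaleW, vecPair_sg]
      rfl
    · simp [h, Ne.symm h]

lemma wordPair_symm (A : GCM I) (v w : List I) :
    wordPair A v (sg w) = wordPair A w (sg v) := by
  have key : ∀ (v : List I) (x : WordSpace I), wordPair A v x = vecPair A x (sg v) := by
    intro v
    induction v with
    | nil =>
      intro x
      refine word_ext_apply counitW ((vecPair A).flip (sg [])) (fun w => ?_) x
      rw [LinearMap.flip_apply, vecPair_sg]
      cases w with
      | nil => rfl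
      | cons j w => rw [counitW_cons, wordPair_cons, lder_nil, map_zero]
    | cons i v ih =>
      intro x
      rw [wordPair_cons, ih, vecPair_lder, lmulW_sg]
  rw [key, vecPair_sg]

/-! ### Linear algebra of tensor products -/

section TensorKill

variable {V W P Q ι κ : Type} [AddCommGroup V] [Module 𝕂 V] [AddCommGroup W] [Module 𝕂 W]
  [AddCommGroup P] [Module 𝕂 P] [AddCommGroup Q] [Module 𝕂 Q]

lemma tensor_map_eq_zero_left (f : V →ₗ[𝕂] P) (φ : ι → V →ₗ[𝕂] 𝕂)
    (hf : ∀ v, (∀ k, φ k v = 0) → f v = 0) (t : V ⊗[𝕂] W)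
    (ht : ∀ k, TensorProduct.lid 𝕂 W (TensorProduct.map (φ k) LinearMap.id t) = 0) :
    TensorProduct.map f (LinearMap.id : W →ₗ[𝕂] W) t = 0 := by
  classical
  let b := Module.Basis.ofVectorSpace 𝕂 W
  apply (TensorProduct.equivFinsuppOfBasisRight (M := P) b).injective
  rw [map_zero]
  ext k
  have h1 : ∀ t : V ⊗[𝕂] W,
      TensorProduct.equivFinsuppOfBasisRight b (TensorProduct.map f (LinearMap.id) t) k =
        f (TensorProduct.equivFinsuppOfBasisRight b t k) := by
    intro t
    induction t using TensorProduct.induction_on with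
    | zero => simp
    | tmul x y => simp
    | add x y hx hy => simp [hx, hy]
  have h2 : ∀ (l : V →ₗ[𝕂] 𝕂) (t : V ⊗[𝕂] W),
      l (TensorProduct.equivFinsuppOfBasisRight b t k) =
        b.repr (TensorProduct.lid 𝕂 W (TensorProduct.map l LinearMap.id t)) k := by
    intro l t
    induction t using TensorProduct.induction_on with
    | zero => simp
    | tmul x y => simp [mul_comm]
    | add x y hx hy => simp [hx, hy]
  rw [h1, hf _ fun j => ?_]
  · rfl
  · rw [h2, ht, map_zero]
    rfl

lemma tensor_map_eq_zero (f : V →ₗ[𝕂] P) (g : W →ₗ[𝕂] Q) (φ : ι → V →ₗ[𝕂] 𝕂)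
    (ψ : κ → W →ₗ[𝕂] 𝕂) (hf : ∀ v, (∀ k, φ k v = 0) → f v = 0)
    (hg : ∀ v, (∀ k, ψ k v = 0) → g v = 0) (t : V ⊗[𝕂] W)
    (ht : ∀ k l, ψ l (TensorProduct.lid 𝕂 W (TensorProduct.map (φ k) LinearMap.id t)) = 0) :
    TensorProduct.map f g t = 0 := by
  have h1 : TensorProduct.map f g t =
      TensorProduct.map f LinearMap.id (TensorProduct.map LinearMap.id g t) := by
    rw [← LinearMap.comp_apply, ← TensorProduct.map_comp]
    rfl
  rw [h1]
  refine tensor_map_eq_zero_left f φ hf _ fun k => ?_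
  have h2 : ∀ t : V ⊗[𝕂] W, TensorProduct.lid 𝕂 Q (TensorProduct.map (φ k) LinearMap.id
      (TensorProduct.map LinearMap.id g t)) =
      g (TensorProduct.lid 𝕂 W (TensorProduct.map (φ k) LinearMap.id t)) := by
    intro t
    induction t using TensorProduct.induction_on with
    | zero => simp
    | tmul x y => simp
    | add x y hx hy => simp only [map_add, hx, hy]
  rw [h2]
  exact hg _ (ht k)

end TensorKill

/-! ### The coproduct and the antipode on words -/

/-- The operator `(θ_j ⊗ 1 + 1 ⊗ θ_j) ·` of the twisted tensor square. -/
def coprodStep (A : GCM I) (j : I) :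
    WordSpace I ⊗[𝕂] WordSpace I →ₗ[𝕂] WordSpace I ⊗[𝕂] WordSpace I :=
  TensorProduct.map (lmulW j) LinearMap.id + TensorProduct.map (torusInvW A j) (lmulW j)

lemma coprodStep_tmul (A : GCM I) (j : I) (a b : WordSpace I) :
    coprodStep A j (a ⊗ₜ b) = lmulW j a ⊗ₜ b + torusInvW A j a ⊗ₜ lmulW j b := rfl

/-- The value of the twisted coproduct on a word. -/
def coprodWord (A : GCM I) : List I → WordSpace I ⊗[𝕂] WordSpace I
  | [] => sg [] ⊗ₜ sg []
  | j :: z => coprodStep A j (coprodWord A z)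

/-- The twisted coproduct on words. -/
def coprodW (A : GCM I) : WordSpace I →ₗ[𝕂] WordSpace I ⊗[𝕂] WordSpace I :=
  onWords (coprodWord A)

lemma coprodW_nil (A : GCM I) : coprodW A (sg []) = sg [] ⊗ₜ sg [] := onWords_sg _ _

lemma coprodW_lmulW (A : GCM I) (j : I) (x : WordSpace I) :
    coprodW A (lmulW j x) = coprodStep A j (coprodW A x) := by
  refine word_ext_apply (coprodW A ∘ₗ lmulW j) (coprodStep A j ∘ₗ coprodW A) (fun w => ?_) x
  simp [lmulW_sg, coprodW, onWords_sg, coprodWord]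

lemma coprodW_lder (A : GCM I) (i : I) (x : WordSpace I) :
    TensorProduct.map (lder A i) LinearMap.id (coprodW A x) = coprodW A (lder A i x) := by
  refine word_ext_apply (TensorProduct.map (lder A i) LinearMap.id ∘ₗ coprodW A)
    (coprodW A ∘ₗ lder A i) (fun w => ?_) x
  simp only [LinearMap.comp_apply]
  induction w with
  | nil => simp [lder_nil, coprodW_nil]
  | cons j w ih =>
    rw [← lmulW_sg, coprodW_lmulW, lder_lmulW, map_add, map_smul, coprodW_lmulW, ← ih]
    have h : ∀ t, TensorProduct.map (lder A i) LinearMap.id (coprodStep A j t) =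
        (if i = j then t else 0) + qh ^ (-ip A (simpleRoot i) (simpleRoot j)) •
          coprodStep A j (TensorProduct.map (lder A i) LinearMap.id t) := by
      intro t
      induction t using TensorProduct.induction_on with
      | zero => simp
      | tmul a b =>
        rw [TensorProduct.map_tmul, coprodStep_tmul, coprodStep_tmul, map_add,
          TensorProduct.map_tmul, TensorProduct.map_tmul, lder_lmulW, torusInvW_lder,
          TensorProduct.add_tmul, smul_add, TensorProduct.smul_tmul', TensorProduct.smul_tmul',
          smul_smul, ← zpow_add₀ qh_ne_zero, ip_symm A (simpleRoot i), neg_add_cancel, zpow_zero,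
          one_smul]
        split_ifs <;> simp [add_assoc]
      | add s t hs ht =>
        simp only [map_add, hs, ht, smul_add]
        split_ifs <;> abel
    rw [h]
    split_ifs <;> simp

lemma counit_coprodW (A : GCM I) (x : WordSpace I) :
    TensorProduct.lid 𝕂 _ (TensorProduct.map counitW LinearMap.id (coprodW A x)) = x := by
  refine word_ext_apply ((TensorProduct.lid 𝕂 (WordSpace I)).toLinearMap ∘ₗ
    TensorProduct.map counitW LinearMap.id ∘ₗ coprodW A) LinearMap.id (fun w => ?_) x
  simp only [LinearMap.comp_apply, LinearEquiv.coe_coe, LinearMap.id_apply]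
  induction w with
  | nil => simp [coprodW_nil, counitW_nil]
  | cons j w ih =>
    rw [← lmulW_sg, coprodW_lmulW]
    nth_rw 2 [← ih]
    generalize coprodW A (sg w) = t
    induction t using TensorProduct.induction_on with
    | zero => simp
    | tmul a b =>
      have h : counitW (torusInvW A j a) = counitW a := by
        have := wordPair_scaleW A (fun β => qh ^ (-ip A (simpleRoot j) β)) [] a
        beta_reduce at this
        rw [wordWt_nil, ip_zero_right, neg_zero, zpow_zero, one_mul] at this
        exact this
      simp [coprodStep_tmul, counitW_lmulW, h]
    | add s t hs ht => simp only [map_add, hs, ht]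

lemma coprodW_counit (A : GCM I) (x : WordSpace I) :
    TensorProduct.rid 𝕂 _ (TensorProduct.map LinearMap.id counitW (coprodW A x)) = x := by
  refine word_ext_apply ((TensorProduct.rid 𝕂 (WordSpace I)).toLinearMap ∘ₗ
    TensorProduct.map LinearMap.id counitW ∘ₗ coprodW A) LinearMap.id (fun w => ?_) x
  simp only [LinearMap.comp_apply, LinearEquiv.coe_coe, LinearMap.id_apply]
  induction w with
  | nil => simp [coprodW_nil, counitW_nil]
  | cons j w ih =>
    rw [← lmulW_sg, coprodW_lmulW]
    nth_rw 2 [← ih]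
    generalize coprodW A (sg w) = t
    induction t using TensorProduct.induction_on with
    | zero => simp
    | tmul a b => simp [coprodStep_tmul, counitW_lmulW]
    | add s t hs ht => simp only [map_add, hs, ht]

lemma wordPair_coprodW (A : GCM I) (v w : List I) (x : WordSpace I) :
    wordPair A v (TensorProduct.lid 𝕂 _
      (TensorProduct.map (wordPair A w) LinearMap.id (coprodW A x))) =
      wordPair A (w ++ v) x := by
  induction w generalizing x with
  | nil => exact congrArg (wordPair A v) (counit_coprodW A x)
  | cons i w ih =>
    rw [List.cons_append, wordPair_cons, ← ih, ← coprodW_lder]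
    have h : TensorProduct.map (wordPair A (i :: w)) (LinearMap.id : WordSpace I →ₗ[𝕂] _) =
        TensorProduct.map (wordPair A w) LinearMap.id ∘ₗ
          TensorProduct.map (lder A i) LinearMap.id := by
      rw [← TensorProduct.map_comp]
      rfl
    rw [h]
    rfl

/-- The span of the tensors of words of total weight `γ`. -/
def bigraded (γ : I →₀ ℤ) : Submodule 𝕂 (WordSpace I ⊗[𝕂] WordSpace I) :=
  Submodule.span 𝕂 {t | ∃ a b : List I, wordWt a + wordWt b = γ ∧ t = sg a ⊗ₜ sg b}

lemma coprodW_mem_bigraded (A : GCM I) (w : List I) :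
    coprodW A (sg w) ∈ bigraded (wordWt w) := by
  induction w with
  | nil =>
    rw [coprodW_nil]
    exact Submodule.subset_span ⟨[], [], by simp [wordWt_nil], rfl⟩
  | cons j w ih =>
    rw [← lmulW_sg, coprodW_lmulW]
    have h : bigraded (wordWt w) ≤ (bigraded (wordWt (j :: w))).comap (coprodStep A j) := by
      refine Submodule.span_le.mpr ?_
      rintro _ ⟨a, b, hab, rfl⟩
      rw [SetLike.mem_coe, Submodule.mem_comap, coprodStep_tmul, torusInvW, scaleW_sg, lmulW_sg,
        lmulW_sg, ← TensorProduct.smul_tmul']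
      refine add_mem (Submodule.subset_span ⟨_, _, ?_, rfl⟩)
        (Submodule.smul_mem _ _ (Submodule.subset_span ⟨_, _, ?_, rfl⟩))
      · rw [wordWt_cons, wordWt_cons, ← hab, add_assoc]
      · rw [wordWt_cons, wordWt_cons, ← hab, add_left_comm]
    exact h ih

/-- A vector is homogeneous of weight `γ`. -/
def IsHomW (γ : I →₀ ℤ) (x : WordSpace I) : Prop := ∀ g, scaleW g x = g γ • x

/-- The indicator function of a weight. -/
def atWt (γ : I →₀ ℤ) : (I →₀ ℤ) → 𝕂 := fun β => if β = γ then 1 else 0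

lemma isHomW_sg (w : List I) : IsHomW (wordWt w) (sg w) := fun g => scaleW_sg g w

lemma isHomW_scaleW_atWt (γ : I →₀ ℤ) (x : WordSpace I) : IsHomW γ (scaleW (atWt γ) x) := by
  intro g
  rw [scaleW_scaleW, ← scaleW_smul]
  congr 2
  funext β
  by_cases h : β = γ <;> simp [atWt, h]

lemma isHomW_eq {γ : I →₀ ℤ} {x : WordSpace I} (hx : IsHomW γ x) : scaleW (atWt γ) x = x := by
  rw [hx]
  simp [atWt]

lemma IsHomW.lder (A : GCM I) {γ : I →₀ ℤ} {x : WordSpace I} (hx : IsHomW γ x) (i : I) :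
    IsHomW (γ - simpleRoot i) (lder A i x) := by
  intro g
  rw [scaleW_lder, hx, map_smul]

lemma IsHomW.rder (A : GCM I) {γ : I →₀ ℤ} {x : WordSpace I} (hx : IsHomW γ x) (i : I) :
    IsHomW (γ - simpleRoot i) (rder A i x) := by
  intro g
  rw [scaleW_rder, hx, map_smul]

lemma IsHomW.revW {γ : I →₀ ℤ} {x : WordSpace I} (hx : IsHomW γ x) : IsHomW γ (revW x) := by
  intro g
  rw [scaleW_revW, hx, map_smul]

lemma IsHomW.eq_zero {γ : I →₀ ℤ} {x : WordSpace I} (hx : IsHomW γ x)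
    (hγ : ∀ w : List I, wordWt w ≠ γ) : x = 0 := by
  rw [← isHomW_eq hx]
  refine word_ext_apply (scaleW (atWt γ)) 0 (fun w => ?_) x
  simp [scaleW_sg, atWt, hγ w]

lemma coprodW_mem_of_isHomW (A : GCM I) {γ : I →₀ ℤ} {x : WordSpace I} (hx : IsHomW γ x) :
    coprodW A x ∈ bigraded γ := by
  rw [← isHomW_eq hx]
  clear hx
  induction x using word_induction with
  | h0 => simp
  | hadd x y hx hy =>
    rw [map_add, map_add]
    exact add_mem hx hy
  | hsmul c x hx =>
    rw [map_smul, map_smul]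
    exact Submodule.smul_mem _ _ hx
  | hw w =>
    rw [scaleW_sg, map_smul]
    by_cases h : wordWt w = γ
    · rw [← h]
      exact Submodule.smul_mem _ _ (coprodW_mem_bigraded A w)
    · simp [atWt, h]

lemma exists_sum_scaleW (x : WordSpace I) :
    ∃ B : Finset (I →₀ ℤ), ∀ B', B ⊆ B' → ∀ g : (I →₀ ℤ) → 𝕂,
      scaleW g x = ∑ β ∈ B', g β • scaleW (atWt β) x := by
  induction x using word_induction with
  | h0 => exact ⟨∅, by simp⟩
  | hadd x y hx hy =>
    obtain ⟨B, hB⟩ := hx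
    obtain ⟨C, hC⟩ := hy
    refine ⟨B ∪ C, fun B' h g => ?_⟩
    rw [map_add, hB B' (Finset.union_subset_left h) g, hC B' (Finset.union_subset_right h) g,
      ← Finset.sum_add_distrib]
    simp
  | hsmul c x hx =>
    obtain ⟨B, hB⟩ := hx
    refine ⟨B, fun B' h g => ?_⟩
    rw [map_smul, hB B' h g, Finset.smul_sum]
    exact Finset.sum_congr rfl fun β _ => by rw [map_smul, smul_comm]
  | hw w =>
    refine ⟨{wordWt w}, fun B' h g => ?_⟩
    rw [Finset.sum_eq_single (wordWt w)]
    · simp [scaleW_sg, atWt]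
    · intro β _ hβ
      simp [scaleW_sg, atWt, hβ.symm]
    · intro h'
      exact absurd (h (Finset.mem_singleton_self _)) h'

lemma map_scaleW_eq_zero {V : Type} [AddCommGroup V] [Module 𝕂 V] (h : WordSpace I →ₗ[𝕂] V)
    (g : (I →₀ ℤ) → 𝕂) (x : WordSpace I) (hx : ∀ β, g β ≠ 0 → h (scaleW (atWt β) x) = 0) :
    h (scaleW g x) = 0 := by
  obtain ⟨B, hB⟩ := exists_sum_scaleW x
  rw [hB B subset_rfl g, map_sum]
  refine Finset.sum_eq_zero fun β _ => ?_
  by_cases hg : g β = 0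
  · simp [hg]
  · rw [map_smul, hx β hg, smul_zero]

/-- The scalar by which the antipode differs from reversal in weight `β`. -/
def antiScalar (A : GCM I) (β : I →₀ ℤ) : 𝕂 :=
  (-1) ^ height β * sqv ^ (2 * rhoPair A β - ip A β β)

lemma antiScalar_add (A : GCM I) (j : I) (β : I →₀ ℤ) :
    antiScalar A (simpleRoot j + β) = -(antiScalar A β * qh ^ (-ip A (simpleRoot j) β)) := by
  have h1 : (-1 : 𝕂) ≠ 0 := by simp
  have h2 : 2 * rhoPair A (simpleRoot j + β) - ip A (simpleRoot j + β) (simpleRoot j + β) =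
      (2 * rhoPair A β - ip A β β) + 2 * (-ip A (simpleRoot j) β) := by
    rw [rhoPair_add, rhoPair_simpleRoot, ip_add_left, ip_add_right, ip_add_right,
      ip_simpleRoot_self, ip_symm A β (simpleRoot j)]
    ring
  rw [antiScalar, antiScalar, h2, zpow_add₀ sqv_ne_zero, ← qh_zpow, height_add, zpow_add₀ h1,
    height_simpleRoot, zpow_one]
  ring

/-- The antipode of the twisted bialgebra of words. -/
def antiW (A : GCM I) : WordSpace I →ₗ[𝕂] WordSpace I := revW ∘ₗ scaleW (antiScalar A)

lemma antiW_of_isHomW (A : GCM I) {γ : I →₀ ℤ} {x : WordSpace I} (hx : IsHomW γ x) :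
    antiW A x = antiScalar A γ • revW x := by
  rw [antiW, LinearMap.comp_apply, hx, map_smul]

lemma antiW_lmulW (A : GCM I) (j : I) (x : WordSpace I) :
    antiW A (lmulW j x) = -rmulW j (antiW A (torusInvW A j x)) := by
  rw [antiW, LinearMap.comp_apply, LinearMap.comp_apply, scaleW_lmulW, revW_lmulW, torusInvW,
    scaleW_scaleW, ← map_neg, ← map_neg]
  congr 2
  rw [← neg_one_smul 𝕂, ← scaleW_smul]
  congr 2
  funext β
  rw [antiScalar_add, neg_one_mul]

/-! ### Nondegeneracy of the form modulo the Serre relations -/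

section Radical

variable {R : Type} [Ring R] [Algebra 𝕂 R]

/-- Evaluation of words in an algebra. -/
def evalW (f : I → R) : WordSpace I →ₗ[𝕂] R := onWords fun w => (w.map f).prod

lemma evalW_sg (f : I → R) (w : List I) : evalW f (sg w) = (w.map f).prod := onWords_sg _ _

lemma evalW_nil (f : I → R) : evalW f (sg []) = 1 := evalW_sg f []

lemma evalW_lmulW (f : I → R) (j : I) (x : WordSpace I) :
    evalW f (lmulW j x) = f j * evalW f x := by
  refine word_ext_apply (evalW f ∘ₗ lmulW j) (LinearMap.mulLeft 𝕂 (f j) ∘ₗ evalW f)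
    (fun w => ?_) x
  simp [lmulW_sg, evalW_sg]

lemma evalW_rmulW (f : I → R) (j : I) (x : WordSpace I) :
    evalW f (rmulW j x) = evalW f x * f j := by
  refine word_ext_apply (evalW f ∘ₗ rmulW j) (LinearMap.mulRight 𝕂 (f j) ∘ₗ evalW f)
    (fun w => ?_) x
  simp [rmulW_sg, evalW_sg]

lemma evalW_lmulW_pow (f : I → R) (j : I) (k : ℕ) (x : WordSpace I) :
    evalW f ((lmulW j ^ k) x) = f j ^ k * evalW f x := by
  induction k with
  | zero => simp
  | succ k ih => rw [pow_succ', Module.End.mul_apply, evalW_lmulW, ih, pow_succ', mul_assoc]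

/-- A family satisfies the Serre relations, and the relations among its words are stable under
the skew derivations and the torus. -/
structure SerreFamily (A : GCM I) (f : I → R) : Prop where
  serre : ∀ i j, i ≠ j → serreIn A i j (f i) (f j) = 0
  lder : ∀ i x, evalW f x = 0 → evalW f (lder A i x) = 0
  rder : ∀ i x, evalW f x = 0 → evalW f (rder A i x) = 0
  torus : ∀ i x, evalW f x = 0 → evalW f (torusInvW A i x) = 0

/-- The radical of the form on words. -/
def IsRad (A : GCM I) (x : WordSpace I) : Prop := ∀ w, wordPair A w x = 0

lemma IsRad.scaleW {A : GCM I} {x : WordSpace I} (hx : IsRad A x) (g : (I →₀ ℤ) → 𝕂) :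
    IsRad A (scaleW g x) := fun w => by rw [wordPair_scaleW, hx, mul_zero]

lemma IsRad.revW {A : GCM I} {x : WordSpace I} (hx : IsRad A x) : IsRad A (revW x) := fun w => by
  rw [← List.reverse_reverse w, wordPair_revW, hx]

lemma IsRad.lder {A : GCM I} {x : WordSpace I} (hx : IsRad A x) (i : I) : IsRad A (lder A i x) :=
  fun w => hx (i :: w)

lemma IsRad.rder {A : GCM I} {x : WordSpace I} (hx : IsRad A x) (i : I) : IsRad A (rder A i x) :=
  fun w => by rw [← wordPair_append, hx]

lemma scaleW_atWt_zero (x : WordSpace I) : scaleW (atWt 0) x = counitW x • sg [] := by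
  refine word_ext_apply (scaleW (atWt 0)) (counitW.smulRight (sg [])) (fun w => ?_) x
  cases w with
  | nil => simp [scaleW_sg, wordWt_nil, atWt, counitW_nil]
  | cons j w =>
    have h : wordWt (j :: w) ≠ 0 := by
      intro h
      have := height_wordWt (j :: w)
      rw [h, height_zero, List.length_cons] at this
      omega
    simp [scaleW_sg, atWt, h, counitW_cons]

lemma mul_antipode_lmulW (A : GCM I) (f : I → R) (j : I) (x : WordSpace I) :
    LinearMap.mul' 𝕂 R (TensorProduct.map (evalW f ∘ₗ antiW A) (evalW f)
      (coprodW A (lmulW j x))) = 0 := by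
  rw [coprodW_lmulW]
  generalize coprodW A x = t
  induction t using TensorProduct.induction_on with
  | zero => simp
  | tmul a b =>
    rw [coprodStep_tmul, map_add, map_add, TensorProduct.map_tmul, TensorProduct.map_tmul,
      LinearMap.mul'_apply, LinearMap.mul'_apply, LinearMap.comp_apply, LinearMap.comp_apply,
      antiW_lmulW, map_neg, evalW_rmulW, evalW_lmulW, neg_mul, mul_assoc, neg_add_cancel]
  | add s t hs ht => rw [map_add, map_add, map_add, hs, ht, add_zero]

lemma mul_antipode (A : GCM I) (f : I → R) (x : WordSpace I) :
    LinearMap.mul' 𝕂 R (TensorProduct.map (evalW f ∘ₗ antiW A) (evalW f) (coprodW A x)) =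
      counitW x • evalW f (antiW A (sg [])) := by
  refine word_ext_apply (LinearMap.mul' 𝕂 R ∘ₗ
    TensorProduct.map (evalW f ∘ₗ antiW A) (evalW f) ∘ₗ coprodW A)
    (counitW.smulRight (evalW f (antiW A (sg [])))) (fun w => ?_) x
  cases w with
  | nil => simp [coprodW_nil, evalW_nil, counitW_nil]
  | cons j w =>
    rw [← lmulW_sg, LinearMap.comp_apply, LinearMap.comp_apply, mul_antipode_lmulW,
      LinearMap.smulRight_apply, counitW_lmulW, zero_smul]

/-- The projector to the weights of height strictly between `0` and `h`. -/
def midScale (h : ℤ) : (I →₀ ℤ) → 𝕂 := fun β => if 0 < height β ∧ height β < h then 1 else 0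

/-- The projector to the span of the empty word. -/
def unitProj : WordSpace I →ₗ[𝕂] WordSpace I := counitW.smulRight (sg [])

lemma map_midScale {γ : I →₀ ℤ} (hγ : 0 < height γ) {t : WordSpace I ⊗[𝕂] WordSpace I}
    (ht : t ∈ bigraded γ) :
    TensorProduct.map (scaleW (midScale (height γ))) (scaleW (midScale (height γ))) t =
      t - TensorProduct.map unitProj LinearMap.id t -
        TensorProduct.map LinearMap.id unitProj t := by
  induction ht using Submodule.span_induction with
  | zero => simp
  | add s t _ _ hs ht =>
    rw [map_add, map_add, map_add, hs, ht]
    abel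
  | smul c t _ ht => rw [map_smul, map_smul, map_smul, ht, smul_sub, smul_sub]
  | mem t ht =>
    obtain ⟨a, b, hab, rfl⟩ := ht
    have hh : (a.length : ℤ) + b.length = height γ := by
      rw [← hab, height_add, height_wordWt, height_wordWt]
    simp only [TensorProduct.map_tmul, scaleW_sg, midScale, height_wordWt, unitProj,
      LinearMap.smulRight_apply, LinearMap.id_apply]
    rw [← hh] at hγ ⊢
    cases a with
    | nil =>
      cases b with
      | nil => simp at hγ
      | cons j b => simp [counitW_nil, counitW_cons]
    | cons i a =>
      cases b with
      | nil =>
        simp only [counitW_nil, counitW_cons, List.length_nil, Nat.cast_zero, lt_self_iff_false,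
          false_and, if_false, zero_smul, one_smul, TensorProduct.tmul_zero,
          TensorProduct.zero_tmul]
        abel
      | cons j b =>
        rw [if_pos, if_pos, counitW_cons, counitW_cons]
        · simp only [zero_smul, one_smul, TensorProduct.tmul_zero, TensorProduct.zero_tmul]
          abel
        · simp only [List.length_cons]; omega
        · simp only [List.length_cons]; omega

lemma evalW_antiW_eq_neg {A : GCM I} {f : I → R} {γ : I →₀ ℤ} {x : WordSpace I}
    (hγ : 0 < height γ) (hx : IsHomW γ x) (hrad : IsRad A x)
    (ih : ∀ β y, height β < height γ → IsHomW β y → IsRad A y → evalW f y = 0) :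
    evalW f (antiW A x) = -evalW f x := by
  have h0 : TensorProduct.map (evalW f ∘ₗ antiW A ∘ₗ scaleW (midScale (height γ)))
      (evalW f ∘ₗ scaleW (midScale (height γ))) (coprodW A x) = 0 := by
    refine tensor_map_eq_zero _ _ (wordPair A) (wordPair A) (fun v hv => ?_) (fun v hv => ?_) _
      (fun k l => by rw [wordPair_coprodW, hrad])
    · rw [LinearMap.comp_apply, LinearMap.comp_apply, antiW, LinearMap.comp_apply, scaleW_scaleW]
      refine map_scaleW_eq_zero (evalW f ∘ₗ revW) _ v fun β hβ => ?_
      refine ih β _ ?_ (isHomW_scaleW_atWt β v).revW (IsRad.scaleW (A := A) hv _).revW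
      by_contra h
      exact hβ (by simp [midScale, h])
    · refine map_scaleW_eq_zero (evalW f) _ v fun β hβ => ?_
      refine ih β _ ?_ (isHomW_scaleW_atWt β v) (IsRad.scaleW (A := A) hv _)
      by_contra h
      exact hβ (by simp [midScale, h])
  have h1 : ∀ t, LinearMap.mul' 𝕂 R (TensorProduct.map (evalW f ∘ₗ antiW A) (evalW f)
      (TensorProduct.map unitProj LinearMap.id t)) =
      evalW f (antiW A (sg [])) * evalW f (TensorProduct.lid 𝕂 _
        (TensorProduct.map counitW LinearMap.id t)) := by
    intro t
    induction t using TensorProduct.induction_on with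
    | zero => simp
    | tmul a b => simp [unitProj]
    | add s t hs ht => simp only [map_add, hs, ht, mul_add]
  have h2 : ∀ t, LinearMap.mul' 𝕂 R (TensorProduct.map (evalW f ∘ₗ antiW A) (evalW f)
      (TensorProduct.map LinearMap.id unitProj t)) =
      evalW f (antiW A (TensorProduct.rid 𝕂 _ (TensorProduct.map LinearMap.id counitW t))) := by
    intro t
    induction t using TensorProduct.induction_on with
    | zero => simp
    | tmul a b => simp [unitProj, evalW_nil]
    | add s t hs ht => simp only [map_add, hs, ht]
  have h3 : evalW f (antiW A (sg [])) = 1 := by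
    rw [antiW_of_isHomW A (isHomW_sg []), revW_sg, antiScalar]
    simp [wordWt_nil, height_zero, ip_zero_left, rhoPair, evalW_nil]
  have h4 := map_midScale hγ (coprodW_mem_of_isHomW A hx)
  have h5 : TensorProduct.map (evalW f ∘ₗ antiW A ∘ₗ scaleW (midScale (height γ)))
      (evalW f ∘ₗ scaleW (midScale (height γ))) (coprodW A x) =
      TensorProduct.map (evalW f ∘ₗ antiW A) (evalW f)
        (TensorProduct.map (scaleW (midScale (height γ))) (scaleW (midScale (height γ)))
          (coprodW A x)) := by
    rw [← LinearMap.comp_assoc, TensorProduct.map_comp, LinearMap.comp_apply]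
  rw [h5, h4] at h0
  have h6 := congrArg (LinearMap.mul' 𝕂 R) h0
  have h7 : counitW x = 0 := hrad []
  rw [map_sub, map_sub, map_sub, map_sub, h1, h2, mul_antipode, counit_coprodW, coprodW_counit,
    h7, h3, zero_smul, map_zero, one_mul, zero_sub] at h6
  exact (sub_eq_zero.mp h6).symm

lemma ip_self_of_isRad {A : GCM I} {f : I → R} {γ : I →₀ ℤ} {x : WordSpace I}
    (hγ : 0 < height γ) (hx : IsHomW γ x) (hrad : IsRad A x)
    (ih : ∀ β y, height β < height γ → IsHomW β y → IsRad A y → evalW f y = 0)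
    (hne : evalW f x ≠ 0) : ip A γ γ = 2 * rhoPair A γ := by
  have h1 := evalW_antiW_eq_neg hγ hx hrad ih
  have h2 := evalW_antiW_eq_neg hγ hx.revW hrad.revW ih
  rw [antiW_of_isHomW A hx, map_smul] at h1
  rw [antiW_of_isHomW A hx.revW, map_smul, revW_revW] at h2
  have h3 : (antiScalar A γ * antiScalar A γ - 1) • evalW f x = 0 := by
    rw [sub_smul, mul_smul, h2, smul_neg, h1, neg_neg, one_smul, sub_self]
  have h4 := (smul_eq_zero.mp h3).resolve_right hne
  have h5 : antiScalar A γ * antiScalar A γ = sqv ^ (2 * (2 * rhoPair A γ - ip A γ γ)) := by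
    rw [antiScalar, two_mul (2 * rhoPair A γ - ip A γ γ), zpow_add₀ sqv_ne_zero]
    have : ((-1 : 𝕂) ^ height γ) * (-1) ^ height γ = 1 := by
      rw [← mul_zpow]
      simp
    linear_combination (sqv ^ (2 * rhoPair A γ - ip A γ γ)) ^ 2 * this
  have h6 := sqv_zpow_eq_one (h5.symm.trans (sub_eq_zero.mp h4))
  omega

end Radical

section Descent

variable {R : Type} [Ring R] [Algebra 𝕂 R]

lemma lmulW_mem_range {f : I → R} {i : I} (j : I) {r : R}
    (hr : r ∈ LinearMap.range (evalW f ∘ₗ rmulW i)) :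
    f j * r ∈ LinearMap.range (evalW f ∘ₗ rmulW i) := by
  obtain ⟨y, rfl⟩ := hr
  exact ⟨lmulW j y, by
    rw [LinearMap.comp_apply, LinearMap.comp_apply, ← lmulW_rmulW, evalW_lmulW]⟩

lemma pow_mul_mem_range {f : I → R} {i : I} (j : I) (k : ℕ) {r : R}
    (hr : r ∈ LinearMap.range (evalW f ∘ₗ rmulW i)) :
    f j ^ k * r ∈ LinearMap.range (evalW f ∘ₗ rmulW i) := by
  induction k with
  | zero => simpa using hr
  | succ k ih =>
    rw [pow_succ', mul_assoc]
    exact lmulW_mem_range j ih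

lemma serre_leading {A : GCM I} {f : I → R} (hf : SerreFamily A f) {i j : I} (hij : i ≠ j) :
    ∃ (n : ℕ) (c : ℕ → 𝕂),
      f i ^ n * f j = ∑ k ∈ Finset.range n, c k • (f i ^ k * f j * f i ^ (n - k)) := by
  refine ⟨(1 - A.c i j).toNat, fun k => -((-1) ^ (1 - A.c i j).toNat *
    ((-1) ^ k * qBinom (qd A i) (1 - A.c i j).toNat k)), ?_⟩
  have h := hf.serre i j hij
  rw [serreIn, Finset.sum_range_succ, qBinom_self, Nat.sub_self, pow_zero, mul_one, mul_one] at h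
  generalize (1 - A.c i j).toNat = n at h ⊢
  have h1 : ((-1 : 𝕂) ^ n * (-1) ^ n) = 1 := by rw [← mul_pow]; simp
  have h2 := congrArg (fun z => (-1 : 𝕂) ^ n • z) h
  simp only [smul_add, smul_smul, h1, one_smul, smul_zero, Finset.smul_sum] at h2
  rw [← sub_eq_zero, sub_eq_add_neg, add_comm, ← Finset.sum_neg_distrib]
  simpa only [neg_smul, neg_neg] using h2

lemma exists_pow_mem_range_word {A : GCM I} {f : I → R} (hf : SerreFamily A f) (i : I)
    (w : List I) : ∃ N, ∀ k, N ≤ k →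
      f i ^ k * evalW f (sg w) ∈ LinearMap.range (evalW f ∘ₗ rmulW i) := by
  induction w with
  | nil =>
    refine ⟨1, fun k hk => ?_⟩
    obtain ⟨k, rfl⟩ := Nat.exists_eq_add_of_le' hk
    rw [evalW_nil, mul_one, pow_succ]
    exact ⟨(lmulW i ^ k) (sg []), by
      rw [LinearMap.comp_apply, evalW_rmulW, evalW_lmulW_pow, evalW_nil, mul_one]⟩
  | cons j w ih =>
    obtain ⟨N, hN⟩ := ih
    rw [← lmulW_sg, evalW_lmulW]
    by_cases hij : i = j
    · subst hij
      refine ⟨N, fun k hk => ?_⟩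
      rw [← mul_assoc, ← pow_succ]
      exact hN _ (by omega)
    · obtain ⟨n, c, hc⟩ := serre_leading hf hij
      have key : ∀ d b k, N ≤ b + d → n * d ≤ k →
          f i ^ k * (f j * (f i ^ b * evalW f (sg w))) ∈
            LinearMap.range (evalW f ∘ₗ rmulW i) := by
        intro d
        induction d with
        | zero =>
          intro b k hb _
          exact pow_mul_mem_range i k (lmulW_mem_range j (hN b hb))
        | succ d ihd =>
          intro b k hb hk
          obtain ⟨s, rfl⟩ := Nat.exists_eq_add_of_le' ((Nat.le_add_left n (n * d)).trans hk)
          rw [pow_add, mul_assoc, ← mul_assoc _ (f j), hc, Finset.sum_mul, Finset.mul_sum]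
          refine Submodule.sum_mem _ fun l hl => ?_
          rw [Finset.mem_range] at hl
          rw [smul_mul_assoc, mul_smul_comm]
          refine Submodule.smul_mem _ _ ?_
          have h := ihd (n - l + b) (s + l) (by omega) (by
            have : n * (d + 1) = n * d + n := by ring
            omega)
          simpa only [pow_add, mul_assoc] using h
      exact ⟨n * N, fun k hk => by simpa using key N 0 k (by omega) hk⟩

lemma exists_pow_mem_range {A : GCM I} {f : I → R} (hf : SerreFamily A f) (i : I)
    (x : WordSpace I) : ∃ N, ∀ k, N ≤ k →
      f i ^ k * evalW f x ∈ LinearMap.range (evalW f ∘ₗ rmulW i) := by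
  induction x using word_induction with
  | h0 => exact ⟨0, fun k _ => by simp⟩
  | hadd x y hx hy =>
    obtain ⟨N, hN⟩ := hx
    obtain ⟨N', hN'⟩ := hy
    refine ⟨max N N', fun k hk => ?_⟩
    rw [map_add, mul_add]
    exact add_mem (hN k (le_of_max_le_left hk)) (hN' k (le_of_max_le_right hk))
  | hsmul c x hx =>
    obtain ⟨N, hN⟩ := hx
    refine ⟨N, fun k hk => ?_⟩
    rw [map_smul, mul_smul_comm]
    exact Submodule.smul_mem _ _ (hN k hk)
  | hw w => exact exists_pow_mem_range_word hf i w

lemma end_pow_succ_apply {V : Type} [AddCommGroup V] [Module 𝕂 V] (φ : V →ₗ[𝕂] V) (k : ℕ) (x : V) :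
    (φ ^ (k + 1)) x = φ ((φ ^ k) x) := by
  rw [pow_succ', Module.End.mul_apply]

/-- The scalar `q^{-(α_i, α_i)}`. -/
def tq (A : GCM I) (i : I) : 𝕂 := qh ^ (-ip A (simpleRoot i) (simpleRoot i))

/-- The geometric sum `1 + t + ⋯ + t^{k-1}` at `t = q^{-(α_i, α_i)}`. -/
def geo (A : GCM I) (i : I) (k : ℕ) : 𝕂 := ∑ l ∈ Finset.range k, tq A i ^ l

lemma tq_pow (A : GCM I) (i : I) (k : ℕ) : tq A i ^ k = qh ^ (-(2 * A.d i * k)) := by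
  rw [tq, ip_simpleRoot_self, ← zpow_natCast, ← zpow_mul]
  congr 1
  ring

lemma geo_ne_zero (A : GCM I) (i : I) {k : ℕ} (hk : k ≠ 0) : geo A i k ≠ 0 := by
  intro h
  have h1 := geom_sum_mul (tq A i) k
  rw [show ∑ l ∈ Finset.range k, tq A i ^ l = 0 from h, zero_mul, tq_pow] at h1
  have h2 := qh_zpow_eq_one (sub_eq_zero.mp h1.symm)
  have h3 := A.d_pos i
  have h4 : (k : ℤ) ≠ 0 := by exact_mod_cast hk
  have h5 : 2 * A.d i * k ≠ 0 := by positivity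
  omega

lemma geo_succ (A : GCM I) (i : I) (k : ℕ) : geo A i (k + 1) = geo A i k + tq A i ^ k :=
  Finset.sum_range_succ _ _

lemma geo_succ' (A : GCM I) (i : I) (k : ℕ) : geo A i (k + 1) = 1 + tq A i * geo A i k := by
  rw [geo, Finset.sum_range_succ', geo, Finset.mul_sum, pow_zero, add_comm]
  simp only [pow_succ']

lemma lder_lmulW_pow (A : GCM I) (i : I) (k : ℕ) (x : WordSpace I) :
    lder A i ((lmulW i ^ (k + 1)) x) =
      geo A i (k + 1) • (lmulW i ^ k) x + tq A i ^ (k + 1) • (lmulW i ^ (k + 1)) (lder A i x) := by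
  induction k with
  | zero => simp [lder_lmulW, geo, tq]
  | succ k ih =>
    rw [end_pow_succ_apply _ (k + 1) x, lder_lmulW, if_pos rfl, ih, map_add, map_smul, map_smul,
      ← tq,
      smul_add, smul_smul, smul_smul, ← pow_succ', geo_succ' A i (k + 1), add_smul, one_smul,
      ← end_pow_succ_apply, ← end_pow_succ_apply, ← add_assoc]

lemma torusInvW_lmulW_pow (A : GCM I) (i : I) (k : ℕ) (x : WordSpace I) :
    torusInvW A i ((lmulW i ^ k) x) = tq A i ^ k • (lmulW i ^ k) (torusInvW A i x) := by
  induction k with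
  | zero => simp
  | succ k ih =>
    rw [pow_succ', Module.End.mul_apply, torusInvW_lmulW, ih, map_smul, smul_smul, ← tq, pow_succ',
      Module.End.mul_apply]

lemma rder_lmulW_pow (A : GCM I) (i : I) (k : ℕ) (x : WordSpace I) :
    rder A i ((lmulW i ^ (k + 1)) x) =
      geo A i (k + 1) • (lmulW i ^ k) (torusInvW A i x) + (lmulW i ^ (k + 1)) (rder A i x) := by
  induction k with
  | zero => simp [rder_lmulW, geo]
  | succ k ih =>
    rw [end_pow_succ_apply _ (k + 1) x, rder_lmulW, if_pos rfl, ih, map_add, map_smul,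
      torusInvW_lmulW_pow, geo_succ A i (k + 1), add_smul, ← end_pow_succ_apply,
      ← end_pow_succ_apply, ← add_assoc, add_comm (tq A i ^ (k + 1) • _)]

lemma rder_rmulW_pow (A : GCM I) (i : I) (k : ℕ) (x : WordSpace I) :
    rder A i ((rmulW i ^ (k + 1)) x) =
      geo A i (k + 1) • (rmulW i ^ k) x + tq A i ^ (k + 1) • (rmulW i ^ (k + 1)) (rder A i x) := by
  induction k with
  | zero => simp [rder_rmulW, geo, tq]
  | succ k ih =>
    rw [end_pow_succ_apply _ (k + 1) x, rder_rmulW, if_pos rfl, ih, map_add, map_smul, map_smul,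
      ← tq,
      smul_add, smul_smul, smul_smul, ← pow_succ', geo_succ' A i (k + 1), add_smul, one_smul,
      ← end_pow_succ_apply, ← end_pow_succ_apply, ← add_assoc]

/-- The operator `l_i - q^{-(α_i, ·)} r_i`, which preserves right multiples of the letter `i`. -/
def skewDiff (A : GCM I) (i : I) : WordSpace I →ₗ[𝕂] WordSpace I :=
  lder A i - torusInvW A i ∘ₗ rder A i

lemma skewDiff_rmulW (A : GCM I) (i : I) (y : WordSpace I) :
    skewDiff A i (rmulW i y) =
      rmulW i (lder A i y - tq A i ^ 2 • torusInvW A i (rder A i y)) := by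
  rw [skewDiff, LinearMap.sub_apply, LinearMap.comp_apply, lder_rmulW, rder_rmulW, if_pos rfl,
    if_pos rfl, map_add, map_smul, torusInvW_rmulW, ← tq, smul_smul, map_sub, map_smul, sq]
  abel

lemma SerreFamily.skewDiff {A : GCM I} {f : I → R} (hf : SerreFamily A f) (i : I)
    {x : WordSpace I} (hx : evalW f x = 0) : evalW f (skewDiff A i x) = 0 := by
  rw [_root_.skewDiff, LinearMap.sub_apply, LinearMap.comp_apply, map_sub, hf.lder i x hx,
    hf.torus i _ (hf.rder i x hx), sub_zero]

lemma SerreFamily.skewDiff_mem {A : GCM I} {f : I → R} (hf : SerreFamily A f) (i : I)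
    {x : WordSpace I} (hx : evalW f x ∈ LinearMap.range (evalW f ∘ₗ rmulW i)) :
    evalW f (_root_.skewDiff A i x) ∈ LinearMap.range (evalW f ∘ₗ rmulW i) := by
  obtain ⟨y, hy⟩ := hx
  have h := hf.skewDiff i (x := x - rmulW i y) (by
    rw [map_sub, ← hy, LinearMap.comp_apply, sub_self])
  rw [map_sub, map_sub, sub_eq_zero, skewDiff_rmulW] at h
  rw [h]
  exact ⟨_, rfl⟩

lemma evalW_skewDiff_pow {A : GCM I} {f : I → R} (hf : SerreFamily A f) {i : I} {γ : I →₀ ℤ}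
    {x : WordSpace I} (hx : IsHomW γ x) (hl : evalW f (lder A i x) = 0)
    (hr : evalW f (rder A i x) = 0) (k : ℕ) :
    evalW f (skewDiff A i ((lmulW i ^ (k + 1)) x)) =
      (geo A i (k + 1) * (1 - tq A i ^ k * qh ^ (-(2 * ip A (simpleRoot i) γ)))) •
        evalW f ((lmulW i ^ k) x) := by
  have ht : torusInvW A i x = qh ^ (-ip A (simpleRoot i) γ) • x := hx _
  have h1 : evalW f (torusInvW A i ((lmulW i ^ (k + 1)) (rder A i x))) = 0 :=
    hf.torus i _ (by rw [evalW_lmulW_pow, hr, mul_zero])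
  rw [skewDiff, LinearMap.sub_apply, LinearMap.comp_apply, lder_lmulW_pow, rder_lmulW_pow,
    map_sub, map_add, map_add, map_add, map_smul, map_smul, map_smul, map_smul,
    evalW_lmulW_pow f i (k + 1), hl, mul_zero, smul_zero, add_zero, h1, add_zero,
    torusInvW_lmulW_pow, ht, map_smul, map_smul, ht, map_smul, map_smul, map_smul, map_smul,
    smul_smul, smul_smul, smul_smul, ← sub_smul]
  congr 1
  have h2 : qh ^ (-(2 * ip A (simpleRoot i) γ)) =
      qh ^ (-ip A (simpleRoot i) γ) * qh ^ (-ip A (simpleRoot i) γ) := by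
    rw [← zpow_add₀ qh_ne_zero]
    congr 1
    ring
  rw [h2]
  ring

lemma exists_right_factor {A : GCM I} {f : I → R} (hf : SerreFamily A f) {i : I} {γ : I →₀ ℤ}
    {x : WordSpace I} (hx : IsHomW γ x) (hpos : 0 < ip A (simpleRoot i) γ)
    (hl : evalW f (lder A i x) = 0) (hr : evalW f (rder A i x) = 0) :
    evalW f x ∈ LinearMap.range (evalW f ∘ₗ rmulW i) := by
  obtain ⟨N, hN⟩ := exists_pow_mem_range hf i x
  have h : evalW f ((lmulW i ^ N) x) ∈ LinearMap.range (evalW f ∘ₗ rmulW i) := by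
    rw [evalW_lmulW_pow]
    exact hN N le_rfl
  clear hN
  induction N with
  | zero => simpa using h
  | succ k ih =>
    apply ih
    have h1 := hf.skewDiff_mem i h
    rw [evalW_skewDiff_pow hf hx hl hr] at h1
    refine (Submodule.smul_mem_iff _ (mul_ne_zero (geo_ne_zero A i (Nat.succ_ne_zero k)) ?_)).mp h1
    intro h0
    rw [tq_pow, ← zpow_add₀ qh_ne_zero] at h0
    have h2 := qh_zpow_eq_one (sub_eq_zero.mp h0).symm
    have h3 : 0 ≤ 2 * A.d i * (k : ℤ) := by
      have := A.d_pos i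
      positivity
    omega

lemma exists_rder_pow_eq_zero (A : GCM I) (i : I) (y : WordSpace I) :
    ∃ N, ∀ k, N ≤ k → (rder A i ^ k) y = 0 := by
  induction y using word_induction with
  | h0 => exact ⟨0, fun k _ => map_zero _⟩
  | hadd x y hx hy =>
    obtain ⟨N, hN⟩ := hx
    obtain ⟨N', hN'⟩ := hy
    refine ⟨max N N', fun k hk => ?_⟩
    rw [map_add, hN k (le_of_max_le_left hk), hN' k (le_of_max_le_right hk), add_zero]
  | hsmul c x hx =>
    obtain ⟨N, hN⟩ := hx
    exact ⟨N, fun k hk => by rw [map_smul, hN k hk, smul_zero]⟩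
  | hw w =>
    refine ⟨w.length + 1, fun k hk => ?_⟩
    have h : ∀ k : ℕ, ∃ β, height β = (w.length : ℤ) - k ∧ IsHomW β ((rder A i ^ k) (sg w)) := by
      intro k
      induction k with
      | zero => exact ⟨wordWt w, by simp [height_wordWt], isHomW_sg w⟩
      | succ k ih =>
        obtain ⟨β, h1, h2⟩ := ih
        refine ⟨β - simpleRoot i, ?_, ?_⟩
        · rw [height_sub, h1, height_simpleRoot]
          push_cast
          ring
        · rw [pow_succ', Module.End.mul_apply]
          exact h2.rder A i
    obtain ⟨β, h1, h2⟩ := h k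
    refine h2.eq_zero fun v hv => ?_
    have := height_wordWt v
    rw [hv, h1] at this
    omega

lemma evalW_eq_zero_of_ip_pos {A : GCM I} {f : I → R} (hf : SerreFamily A f) {i : I} {γ : I →₀ ℤ}
    {x : WordSpace I} (hx : IsHomW γ x) (hpos : 0 < ip A (simpleRoot i) γ)
    (hl : evalW f (lder A i x) = 0) (hr : evalW f (rder A i x) = 0) : evalW f x = 0 := by
  obtain ⟨y, hy⟩ := exists_right_factor hf hx hpos hl hr
  have key : ∀ k, ∃ c : 𝕂, evalW f x = c • evalW f ((rmulW i ^ (k + 1)) ((rder A i ^ k) y)) := by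
    intro k
    induction k with
    | zero => exact ⟨1, by rw [one_smul, ← hy]; simp⟩
    | succ k ih =>
      obtain ⟨c, hc⟩ := ih
      have h1 := hf.rder i (x - c • (rmulW i ^ (k + 1)) ((rder A i ^ k) y)) (by
        rw [map_sub, map_smul, hc, sub_self])
      rw [map_sub, map_sub, hr, zero_sub, neg_eq_zero, map_smul, map_smul, rder_rmulW_pow] at h1
      have h2 := congrArg (· * f i) h1
      simp only [zero_mul, smul_mul_assoc, ← evalW_rmulW] at h2
      rw [map_add, map_smul, map_smul, ← end_pow_succ_apply, ← end_pow_succ_apply,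
        ← end_pow_succ_apply, map_add, map_smul, map_smul, smul_add, smul_comm c, ← hc] at h2
      refine ⟨-((geo A i (k + 1))⁻¹ * (c * tq A i ^ (k + 1))), ?_⟩
      have h3 := congrArg ((geo A i (k + 1))⁻¹ • ·) h2
      simp only [smul_add, smul_zero, smul_smul,
        inv_mul_cancel₀ (geo_ne_zero A i (Nat.succ_ne_zero k)), one_smul] at h3
      rw [neg_smul]
      exact eq_neg_of_add_eq_zero_left h3
  obtain ⟨N, hN⟩ := exists_rder_pow_eq_zero A i y
  obtain ⟨c, hc⟩ := key N
  rw [hc, hN N le_rfl, map_zero, map_zero, smul_zero]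

lemma rhoPair_wordWt_pos (A : GCM I) (w : List I) : (w.length : ℤ) ≤ rhoPair A (wordWt w) := by
  induction w with
  | nil => simp [wordWt_nil, rhoPair]
  | cons j w ih =>
    rw [wordWt_cons, rhoPair_add, rhoPair_simpleRoot, List.length_cons]
    have := A.d_pos j
    push_cast
    omega

/-- Homogeneous elements of the radical of the form vanish in any Serre family. -/
lemma SerreFamily.evalW_eq_zero_of_isHomW {A : GCM I} {f : I → R} (hf : SerreFamily A f) (n : ℕ) :
    ∀ γ x, height γ < n → IsHomW γ x → IsRad A x → evalW f x = 0 := by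
  induction n with
  | zero =>
    intro γ x hγ hx _
    rw [hx.eq_zero, map_zero]
    intro w hw
    have := height_wordWt w
    rw [hw] at this
    push_cast at hγ
    omega
  | succ n ih =>
    intro γ x hγ hx hrad
    by_cases hw : ∀ w : List I, wordWt w ≠ γ
    · rw [hx.eq_zero hw, map_zero]
    push Not at hw
    obtain ⟨w, rfl⟩ := hw
    have hw := height_wordWt w
    rcases Nat.eq_zero_or_pos w.length with h0 | h0
    · rw [List.length_eq_zero_iff] at h0
      subst h0
      rw [← isHomW_eq hx, wordWt_nil, scaleW_atWt_zero, show counitW x = 0 from hrad [], zero_smul,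
        map_zero]
    by_contra hne
    have ih' : ∀ β y, height β < height (wordWt w) → IsHomW β y → IsRad A y → evalW f y = 0 :=
      fun β y hβ => ih β y (by push_cast at hγ; omega)
    have h1 := ip_self_of_isRad (by omega) hx hrad ih' hne
    have h2 := rhoPair_wordWt_pos A w
    have h3 : ip A (wordWt w) (wordWt w) ≤ 0 := by
      rw [ip_eq_sum]
      refine Finset.sum_nonpos fun i _ => ?_
      rw [wordWt_apply]
      refine mul_nonpos_of_nonneg_of_nonpos (by positivity) ?_
      by_contra hi
      have hlt : height (wordWt w - simpleRoot i) < height (wordWt w) := by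
        rw [height_sub, height_simpleRoot]
        omega
      exact hne (evalW_eq_zero_of_ip_pos hf hx (not_le.mp hi)
        (ih' _ _ hlt (hx.lder A i) (hrad.lder i)) (ih' _ _ hlt (hx.rder A i) (hrad.rder i)))
    omega

/-- The radical of the form on words vanishes in any Serre family. -/
theorem SerreFamily.evalW_eq_zero {A : GCM I} {f : I → R} (hf : SerreFamily A f)
    {x : WordSpace I} (hx : IsRad A x) : evalW f x = 0 := by
  rw [← one_smul 𝕂 x, ← scaleW_const]
  refine map_scaleW_eq_zero (evalW f) _ x fun β _ => ?_
  exact hf.evalW_eq_zero_of_isHomW ((height β).toNat + 1) β _ (by push_cast; omega)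
    (isHomW_scaleW_atWt β x) (hx.scaleW _)

end Descent

/-! ### Words in a single level of the bosonic extension -/

lemma map_serreIn {R S : Type} [Ring R] [Algebra 𝕂 R] [Ring S] [Algebra 𝕂 S] (A : GCM I)
    (φ : R →ₐ[𝕂] S) (i j : I) (a b : R) :
    φ (serreIn A i j a b) = serreIn A i j (φ a) (φ b) := by
  simp [serreIn, map_sum]

lemma serreIn_smul {R : Type} [Ring R] [Algebra 𝕂 R] (A : GCM I) (i j : I) (s t : 𝕂) (a b : R) :
    serreIn A i j (s • a) (t • b) =
      (s ^ (1 - A.c i j).toNat * t) • serreIn A i j a b := by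
  rw [serreIn, serreIn, Finset.smul_sum]
  refine Finset.sum_congr rfl fun k hk => ?_
  have hk' : k ≤ (1 - A.c i j).toNat := Nat.lt_succ_iff.mp (Finset.mem_range.mp hk)
  rw [smul_pow, smul_pow, smul_mul_smul_comm, smul_mul_smul_comm, smul_smul, smul_smul]
  congr 1
  have h : s ^ (1 - A.c i j).toNat = s ^ k * s ^ ((1 - A.c i j).toNat - k) := by
    rw [← pow_add, Nat.add_sub_cancel' hk']
  rw [h]
  ring

lemma ff_serre (A : GCM I) (i j : I) (p : ℤ) (h : i ≠ j) :
    serreIn A i j (ff A i p) (ff A j p) = 0 := by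
  have := RingQuot.mkAlgHom_rel 𝕂 (hARel.serre (A := A) i j p h)
  rw [map_serreIn, map_zero] at this
  exact this

lemma ff_comm (A : GCM I) (i j : I) {m p : ℤ} (h : m < p) :
    ff A i m * ff A j p =
      qh ^ (((p - m + 1).negOnePow : ℤ) * ip A (simpleRoot i) (simpleRoot j)) •
        (ff A j p * ff A i m) +
      if j = i ∧ p = m + 1 then ((1 : 𝕂) - qd A i ^ 2) • 1 else 0 := by
  have := RingQuot.mkAlgHom_rel 𝕂 (hARel.comm (A := A) i j m p h)
  rw [map_mul, map_add, map_smul, map_mul, apply_ite (RingQuot.mkAlgHom 𝕂 (hARel A)), map_smul,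
    map_one, map_zero, ← ip_simpleRoot] at this
  exact this

lemma ff_comm_next (A : GCM I) (i j : I) (m : ℤ) :
    ff A i m * ff A j (m + 1) =
      qh ^ ip A (simpleRoot i) (simpleRoot j) • (ff A j (m + 1) * ff A i m) +
      if i = j then ((1 : 𝕂) - qd A i ^ 2) • 1 else 0 := by
  rw [ff_comm A i j (lt_add_one m)]
  congr 1
  · rw [show m + 1 - m + 1 = 2 by ring]
    rw [Int.negOnePow_even 2 even_two, Units.val_one, one_mul]
  · simp [eq_comm]

/-- The torus automorphism attached to the root `α_i`. -/
def torusHom (A : GCM I) (n : ℤ) (i : I) : hA A →ₐ[𝕂] hA A :=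
  RingQuot.liftAlgHom 𝕂 ⟨FreeAlgebra.lift 𝕂 fun p : I × ℤ =>
    qh ^ (n * (p.2.negOnePow : ℤ) * ip A (simpleRoot i) (simpleRoot p.1)) • ff A p.1 p.2, by
    intro x y hxy
    cases hxy with
    | serre k j p h =>
      rw [map_serreIn, FreeAlgebra.lift_ι_apply, FreeAlgebra.lift_ι_apply, serreIn_smul,
        ff_serre A k j p h, smul_zero, map_zero]
    | comm k j m p h =>
      simp only [map_add, map_mul, map_smul, FreeAlgebra.lift_ι_apply, smul_mul_smul_comm]
      rw [apply_ite (FreeAlgebra.lift 𝕂 _), map_smul, map_one, map_zero, ff_comm A k j h, smul_add,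
        ip_simpleRoot A k j]
      congr 1
      · rw [smul_smul, smul_smul]
        congr 1
        ring
      · split_ifs with hp
        · obtain ⟨rfl, rfl⟩ := hp
          rw [← zpow_add₀ qh_ne_zero, Int.negOnePow_succ]
          simp
        · rw [smul_zero]⟩

lemma torusHom_ff (A : GCM I) (n : ℤ) (i j : I) (m : ℤ) :
    torusHom A n i (ff A j m) =
      qh ^ (n * (m.negOnePow : ℤ) * ip A (simpleRoot i) (simpleRoot j)) • ff A j m := by
  rw [torusHom, ff, RingQuot.liftAlgHom_mkAlgHom_apply, FreeAlgebra.lift_ι_apply]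
  rfl

/-- Evaluation of words in the letters `f_{i,m}`. -/
def lev (A : GCM I) (m : ℤ) : WordSpace I →ₗ[𝕂] hA A := evalW fun i => ff A i m

lemma lev_nil (A : GCM I) (m : ℤ) : lev A m (sg []) = 1 := evalW_nil _

lemma lev_lmulW (A : GCM I) (m : ℤ) (j : I) (x : WordSpace I) :
    lev A m (lmulW j x) = ff A j m * lev A m x := evalW_lmulW _ j x

lemma lev_cons (A : GCM I) (m : ℤ) (j : I) (w : List I) :
    lev A m (sg (j :: w)) = ff A j m * lev A m (sg w) := by rw [← lmulW_sg, lev_lmulW]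

lemma lev_append (A : GCM I) (m : ℤ) (v w : List I) :
    lev A m (sg (v ++ w)) = lev A m (sg v) * lev A m (sg w) := by
  simp [lev, evalW_sg]

lemma torusHom_lev (A : GCM I) (n : ℤ) (i : I) (m : ℤ) (x : WordSpace I) :
    torusHom A n i (lev A m x) =
      lev A m (scaleW (fun β => qh ^ (n * (m.negOnePow : ℤ) * ip A (simpleRoot i) β)) x) := by
  refine word_ext_apply ((torusHom A n i).toLinearMap ∘ₗ lev A m) (lev A m ∘ₗ scaleW _)
    (fun w => ?_) x
  simp only [LinearMap.comp_apply, AlgHom.toLinearMap_apply, scaleW_sg, map_smul]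
  induction w with
  | nil => simp [lev_nil, wordWt_nil, ip_zero_right]
  | cons j w ih =>
    rw [lev_cons, map_mul, ih, torusHom_ff, smul_mul_smul_comm, ← zpow_add₀ qh_ne_zero, ← mul_add,
      ← ip_add_right, wordWt_cons]

lemma lev_torusInvW (A : GCM I) (i : I) (m : ℤ) {x : WordSpace I} (hx : lev A m x = 0) :
    lev A m (torusInvW A i x) = 0 := by
  have h := torusHom_lev A (-(m.negOnePow : ℤ)) i m x
  rw [hx, map_zero] at h
  rw [h, torusInvW]
  congr 3
  funext β
  rw [neg_mul, ← Units.val_mul, Int.units_mul_self, Units.val_one, neg_one_mul]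

lemma lev_torusW (A : GCM I) (i : I) (m : ℤ) {x : WordSpace I} (hx : lev A m x = 0) :
    lev A m (torusW A i x) = 0 := by
  have h := torusHom_lev A (m.negOnePow : ℤ) i m x
  rw [hx, map_zero] at h
  rw [h, torusW]
  congr 3
  funext β
  rw [← Units.val_mul, Int.units_mul_self, Units.val_one, one_mul]

lemma torusW_lder_lmulW (A : GCM I) (i j : I) (x : WordSpace I) :
    torusW A i (lder A i (lmulW j x)) =
      (if i = j then torusW A i x else 0) + lmulW j (torusW A i (lder A i x)) := by
  rw [lder_lmulW, map_add, map_smul, torusW_lmulW, smul_smul, ← zpow_add₀ qh_ne_zero,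
    neg_add_cancel, zpow_zero, one_smul, apply_ite (torusW A i), map_zero]

lemma torusW_torusInvW (A : GCM I) (i : I) (x : WordSpace I) :
    torusW A i (torusInvW A i x) = x := by
  rw [torusW, torusInvW, scaleW_scaleW]
  simp only [zpow_neg, mul_inv_cancel₀ (zpow_ne_zero _ qh_ne_zero), scaleW_const, one_smul]

lemma torusW_rder_lmulW (A : GCM I) (i j : I) (x : WordSpace I) :
    torusW A i (rder A i (lmulW j x)) = (if i = j then x else 0) +
      qh ^ ip A (simpleRoot i) (simpleRoot j) • lmulW j (torusW A i (rder A i x)) := by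
  rw [rder_lmulW, map_add, torusW_lmulW, apply_ite (torusW A i), map_zero, torusW_torusInvW]

lemma lev_mul_ff (A : GCM I) (i : I) (m : ℤ) (x : WordSpace I) :
    lev A m x * ff A i (m + 1) = ff A i (m + 1) * lev A m (torusW A i x) +
      ((1 : 𝕂) - qd A i ^ 2) • lev A m (torusW A i (lder A i x)) := by
  refine word_ext_apply (LinearMap.mulRight 𝕂 (ff A i (m + 1)) ∘ₗ lev A m)
    (LinearMap.mulLeft 𝕂 (ff A i (m + 1)) ∘ₗ lev A m ∘ₗ torusW A i +
      ((1 : 𝕂) - qd A i ^ 2) • lev A m ∘ₗ torusW A i ∘ₗ lder A i) (fun w => ?_) x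
  simp only [LinearMap.comp_apply, LinearMap.add_apply, LinearMap.smul_apply,
    LinearMap.mulRight_apply, LinearMap.mulLeft_apply]
  induction w with
  | nil => simp [lder_nil, torusW_nil, lev_nil]
  | cons j w ih =>
    rw [← lmulW_sg, lev_lmulW, mul_assoc, ih, torusW_lmulW, torusW_lder_lmulW, map_smul, map_add,
      lev_lmulW, lev_lmulW, mul_add, ← mul_assoc, ff_comm_next, add_mul, smul_mul_assoc,
      mul_smul_comm, mul_smul_comm, mul_assoc, smul_add, ip_symm A (simpleRoot j), add_assoc]
    congr 1
    congr 1
    by_cases h : i = j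
    · subst h; simp
    · simp [h, Ne.symm h]

lemma ff_mul_lev (A : GCM I) (i : I) (m : ℤ) (x : WordSpace I) :
    ff A i m * lev A (m + 1) x = lev A (m + 1) (torusW A i x) * ff A i m +
      ((1 : 𝕂) - qd A i ^ 2) • lev A (m + 1) (torusW A i (rder A i x)) := by
  refine word_ext_apply (LinearMap.mulLeft 𝕂 (ff A i m) ∘ₗ lev A (m + 1))
    (LinearMap.mulRight 𝕂 (ff A i m) ∘ₗ lev A (m + 1) ∘ₗ torusW A i +
      ((1 : 𝕂) - qd A i ^ 2) • lev A (m + 1) ∘ₗ torusW A i ∘ₗ rder A i) (fun w => ?_) x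
  simp only [LinearMap.comp_apply, LinearMap.add_apply, LinearMap.smul_apply,
    LinearMap.mulRight_apply, LinearMap.mulLeft_apply]
  induction w with
  | nil => simp [rder_nil, torusW_nil, lev_nil]
  | cons j w ih =>
    rw [← lmulW_sg, lev_lmulW, ← mul_assoc, ff_comm_next, add_mul, smul_mul_assoc, mul_assoc, ih,
      torusW_lmulW, torusW_rder_lmulW, map_smul, map_add, map_smul, lev_lmulW, lev_lmulW, mul_add,
      mul_smul_comm, smul_mul_assoc, smul_add, smul_add, mul_assoc, add_assoc]
    congr 1
    rw [add_comm, smul_comm]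
    congr 1
    by_cases h : i = j
    · subst h; simp
    · simp [h]

/-- The generators in a fixed level form a Serre family. -/
lemma serreFamily_ff (A : GCM I) (m : ℤ) : SerreFamily A fun i => ff A i m where
  serre i j h := ff_serre A i j m h
  torus i x hx := lev_torusInvW A i m hx
  lder i x hx := by
    have h := lev_mul_ff A i m x
    rw [show lev A m x = 0 from hx, lev_torusW A i m hx, zero_mul, mul_zero, zero_add, eq_comm,
      smul_eq_zero] at h
    have h' := lev_torusInvW A i m (h.resolve_left (zi_ne_zero A i))
    rwa [torusInvW_torusW] at h'
  rder i x hx := by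
    obtain ⟨m, rfl⟩ : ∃ n, m = n + 1 := ⟨m - 1, by ring⟩
    have h := ff_mul_lev A i m x
    rw [show lev A (m + 1) x = 0 from hx, lev_torusW A i (m + 1) hx, zero_mul, mul_zero, zero_add,
      eq_comm, smul_eq_zero] at h
    have h' := lev_torusInvW A i (m + 1) (h.resolve_left (zi_ne_zero A i))
    rwa [torusInvW_torusW] at h'

lemma lev_eq_zero (A : GCM I) (m : ℤ) {x : WordSpace I} (hx : ∀ w, wordPair A w x = 0) :
    lev A m x = 0 :=
  (serreFamily_ff A m).evalW_eq_zero hx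

/-! ### Monomials and ordered factorizations -/

/-- The monomial of a list of generators. -/
def mon (A : GCM I) (l : List (I × ℤ)) : hA A := (l.map fun p => ff A p.1 p.2).prod

/-- The weight of a monomial. -/
def monWt (l : List (I × ℤ)) : I →₀ ℤ :=
  (l.map fun p => Finsupp.single p.1 (((p.2 + 1).negOnePow : ℤ))).sum

lemma mon_mem_hAwt (A : GCM I) (l : List (I × ℤ)) : mon A l ∈ hAwt A (monWt l) :=
  Submodule.subset_span ⟨l, rfl, rfl⟩

lemma mon_nil (A : GCM I) : mon A [] = 1 := rfl

lemma mon_cons (A : GCM I) (p : I × ℤ) (l : List (I × ℤ)) :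
    mon A (p :: l) = ff A p.1 p.2 * mon A l := by simp [mon]

lemma mon_append (A : GCM I) (l l' : List (I × ℤ)) : mon A (l ++ l') = mon A l * mon A l' := by
  simp [mon]

lemma monWt_cons (p : I × ℤ) (l : List (I × ℤ)) :
    monWt (p :: l) = ((p.2 + 1).negOnePow : ℤ) • simpleRoot p.1 + monWt l := by
  simp [monWt, simpleRoot]

lemma monWt_append (l l' : List (I × ℤ)) : monWt (l ++ l') = monWt l + monWt l' := by
  simp [monWt]

/-- A word placed in level `m`. -/
def atLevel (m : ℤ) (w : List I) : List (I × ℤ) := w.map fun i => (i, m)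

lemma mon_atLevel (A : GCM I) (m : ℤ) (w : List I) : mon A (atLevel m w) = lev A m (sg w) := by
  rw [mon, lev, evalW_sg, atLevel, List.map_map]
  rfl

lemma monWt_atLevel (m : ℤ) (w : List I) :
    monWt (atLevel m w) = ((m + 1).negOnePow : ℤ) • wordWt w := by
  induction w with
  | nil => simp [atLevel, monWt, wordWt_nil]
  | cons j w ih =>
    rw [wordWt_cons, smul_add, ← ih]
    exact monWt_cons (j, m) (atLevel m w)

lemma ff_comm_far (A : GCM I) (i j : I) {m p : ℤ} (h : m + 1 < p) :
    ff A i m * ff A j p = qh ^ (-ip A (((m + 1).negOnePow : ℤ) • simpleRoot i)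
      (((p + 1).negOnePow : ℤ) • simpleRoot j)) • (ff A j p * ff A i m) := by
  rw [ff_comm A i j (by omega), if_neg (fun h' => by omega), add_zero, ip_smul_left, ip_smul_right]
  congr 2
  rw [show p - m + 1 = (p + 1) - (m + 1) + 1 by ring, Int.negOnePow_succ, Int.negOnePow_sub]
  push_cast
  ring

lemma ff_mul_mon_far (A : GCM I) (i : I) (m : ℤ) (l : List (I × ℤ)) (h : ∀ p ∈ l, m + 1 < p.2) :
    ff A i m * mon A l = qh ^ (-ip A (((m + 1).negOnePow : ℤ) • simpleRoot i) (monWt l)) •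
      (mon A l * ff A i m) := by
  induction l with
  | nil => simp [mon, monWt, ip_zero_right]
  | cons p l ih =>
    rw [mon_cons, ← mul_assoc, ff_comm_far A i p.1 (h p List.mem_cons_self), smul_mul_assoc,
      mul_assoc, ih fun p' hp' => h p' (List.mem_cons_of_mem _ hp'), mul_smul_comm, smul_smul,
      ← zpow_add₀ qh_ne_zero, monWt_cons, ip_add_right, neg_add, mul_assoc]

lemma mon_mul_mon_far (A : GCM I) (l l' : List (I × ℤ))
    (h : ∀ p ∈ l, ∀ p' ∈ l', p.2 + 1 < p'.2) :
    mon A l * mon A l' = qh ^ (-ip A (monWt l) (monWt l')) • (mon A l' * mon A l) := by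
  induction l with
  | nil => simp [mon, monWt, ip_zero_left]
  | cons p l ih =>
    rw [mon_cons, mul_assoc, ih fun q hq => h q (List.mem_cons_of_mem _ hq), mul_smul_comm,
      ← mul_assoc, ff_mul_mon_far A p.1 p.2 l' (h p List.mem_cons_self), smul_mul_assoc, smul_smul,
      ← zpow_add₀ qh_ne_zero, monWt_cons, ip_add_left, neg_add, mul_assoc, add_comm]

/-- The subalgebra generated by the generators with level in a given set. -/
def levSub (A : GCM I) (P : ℤ → Prop) : Subalgebra 𝕂 (hA A) :=
  Algebra.adjoin 𝕂 {x | ∃ i k, P k ∧ x = ff A i k}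

lemma ff_mem_levSub (A : GCM I) {P : ℤ → Prop} (i : I) {k : ℤ} (hk : P k) :
    ff A i k ∈ levSub A P := Algebra.subset_adjoin ⟨i, k, hk, rfl⟩

lemma levSub_mono (A : GCM I) {P Q : ℤ → Prop} (h : ∀ k, P k → Q k) :
    levSub A P ≤ levSub A Q :=
  Algebra.adjoin_mono fun _ ⟨i, k, hk, hx⟩ => ⟨i, k, h k hk, hx⟩

lemma hAband_eq (A : GCM I) (a b : ℤ) : hAband A a b = levSub A fun k => a ≤ k ∧ k ≤ b := by
  simp only [hAband, levSub, and_assoc]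

lemma hAk_eq (A : GCM I) (m : ℤ) : hAk A m = levSub A (· = m) := by
  rw [hAk, hAband_eq]
  congr 1
  funext k
  exact propext (by omega)

lemma hAle_eq (A : GCM I) (m : ℤ) : hAle A m = levSub A (· ≤ m) := rfl

lemma hAlt_eq (A : GCM I) (m : ℤ) : hAlt A m = levSub A (· < m) := by
  rw [hAlt, hAle_eq]
  congr 1
  funext k
  exact propext (by omega)

lemma mon_mem_levSub (A : GCM I) {P : ℤ → Prop} (l : List (I × ℤ)) (h : ∀ p ∈ l, P p.2) :
    mon A l ∈ levSub A P := by
  refine Subalgebra.list_prod_mem _ fun x hx => ?_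
  obtain ⟨p, hp, rfl⟩ := List.mem_map.mp hx
  exact ff_mem_levSub A p.1 (h p hp)

lemma mem_levSub_iff (A : GCM I) (P : ℤ → Prop) (x : hA A) :
    x ∈ levSub A P ↔ x ∈ Submodule.span 𝕂 {y | ∃ l, (∀ p ∈ l, P p.2) ∧ y = mon A l} := by
  constructor
  · intro hx
    rw [← Subalgebra.mem_toSubmodule, levSub, Algebra.adjoin_eq_span] at hx
    refine Submodule.span_mono ?_ hx
    intro y hy
    induction hy using Submonoid.closure_induction with
    | mem y hy =>
      obtain ⟨i, k, hk, rfl⟩ := hy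
      exact ⟨[(i, k)], by simpa using hk, by simp [mon]⟩
    | one => exact ⟨[], by simp, rfl⟩
    | mul y z _ _ hy hz =>
      obtain ⟨l, hl, rfl⟩ := hy
      obtain ⟨l', hl', rfl⟩ := hz
      refine ⟨l ++ l', fun p hp => ?_, (mon_append A l l').symm⟩
      exact (List.mem_append.mp hp).elim (hl p) (hl' p)
  · intro hx
    rw [← Subalgebra.mem_toSubmodule]
    refine Submodule.span_le.mpr ?_ hx
    rintro _ ⟨l, hl, rfl⟩
    exact mon_mem_levSub A l hl

lemma lev_mem_hAk (A : GCM I) (m : ℤ) (x : WordSpace I) : lev A m x ∈ hAk A m := by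
  rw [hAk_eq]
  induction x using word_induction with
  | h0 => rw [map_zero]; exact zero_mem _
  | hadd x y hx hy => rw [map_add]; exact add_mem hx hy
  | hsmul c x hx => rw [map_smul]; exact Subalgebra.smul_mem _ hx c
  | hw w =>
    rw [← mon_atLevel]
    refine mon_mem_levSub A _ fun p hp => ?_
    obtain ⟨i, _, rfl⟩ := List.mem_map.mp hp
    rfl

lemma exists_lev_eq (A : GCM I) (m : ℤ) {y : hA A} (hy : y ∈ hAk A m) : ∃ x, y = lev A m x := by
  rw [hAk_eq, mem_levSub_iff] at hy
  induction hy using Submodule.span_induction with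
  | zero => exact ⟨0, (map_zero _).symm⟩
  | add x y _ _ hx hy =>
    obtain ⟨x, rfl⟩ := hx
    obtain ⟨y, rfl⟩ := hy
    exact ⟨x + y, (map_add _ _ _).symm⟩
  | smul c x _ hx =>
    obtain ⟨x, rfl⟩ := hx
    exact ⟨c • x, (map_smul _ _ _).symm⟩
  | mem x hx =>
    obtain ⟨l, hl, rfl⟩ := hx
    refine ⟨sg (l.map Prod.fst), ?_⟩
    rw [← mon_atLevel, atLevel, List.map_map]
    congr 1
    conv_lhs => rw [← List.map_id l]
    exact List.map_congr_left fun p hp => Prod.ext rfl (hl p hp)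

/-- Linear combinations of products of an element of level `b` and an element of `S`. -/
def factored (A : GCM I) (b : ℤ) (S : Subalgebra 𝕂 (hA A)) : Submodule 𝕂 (hA A) :=
  Submodule.span 𝕂 {x | ∃ u, ∃ z ∈ S, x = lev A b (sg u) * z}

lemma lev_mul_mem_factored (A : GCM I) (b : ℤ) {S : Subalgebra 𝕂 (hA A)} (x : WordSpace I)
    {z : hA A} (hz : z ∈ S) : lev A b x * z ∈ factored A b S := by
  induction x using word_induction with
  | h0 => rw [map_zero, zero_mul]; exact zero_mem _
  | hadd x y hx hy => rw [map_add, add_mul]; exact add_mem hx hy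
  | hsmul c x hx => rw [map_smul, smul_mul_assoc]; exact Submodule.smul_mem _ c hx
  | hw w => exact Submodule.subset_span ⟨w, z, hz, rfl⟩

lemma exists_ff_mul_lev (A : GCM I) (i : I) {k b : ℤ} (hk : k < b) (u : List I) :
    ∃ x y, ff A i k * lev A b (sg u) = lev A b x * ff A i k + lev A b y := by
  by_cases h : k + 1 = b
  · subst h
    exact ⟨torusW A i (sg u), ((1 : 𝕂) - qd A i ^ 2) • torusW A i (rder A i (sg u)), by
      rw [map_smul]; exact ff_mul_lev A i k (sg u)⟩
  · refine ⟨qh ^ (-ip A (((k + 1).negOnePow : ℤ) • simpleRoot i) (monWt (atLevel b u))) • sg u, 0,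
      ?_⟩
    rw [map_zero, add_zero, ← mon_atLevel, ff_mul_mon_far, map_smul, smul_mul_assoc, ← mon_atLevel]
    intro p hp
    obtain ⟨j, _, rfl⟩ := List.mem_map.mp hp
    change k + 1 < b
    omega

lemma levSub_le_factored (A : GCM I) {P Q : ℤ → Prop} {b : ℤ}
    (h : ∀ k, P k → k = b ∨ (k < b ∧ Q k)) {x : hA A} (hx : x ∈ levSub A P) :
    x ∈ factored A b (levSub A Q) := by
  rw [mem_levSub_iff] at hx
  refine Submodule.span_le.mpr ?_ hx
  rintro _ ⟨l, hl, rfl⟩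
  induction l with
  | nil =>
    have h1 := lev_mul_mem_factored A b (sg []) (one_mem (levSub A Q))
    rwa [lev_nil, one_mul] at h1
  | cons p l ih =>
    rw [mon_cons]
    have h1 := ih fun q hq => hl q (List.mem_cons_of_mem _ hq)
    have h2 : factored A b (levSub A Q) ≤
        (factored A b (levSub A Q)).comap (LinearMap.mulLeft 𝕂 (ff A p.1 p.2)) := by
      refine Submodule.span_le.mpr ?_
      rintro _ ⟨u, z, hz, rfl⟩
      rw [SetLike.mem_coe, Submodule.mem_comap, LinearMap.mulLeft_apply, ← mul_assoc]
      rcases h p.2 (hl p List.mem_cons_self) with hb | ⟨hb, hQ⟩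
      · rw [hb, ← lev_cons]
        exact lev_mul_mem_factored A b _ hz
      · obtain ⟨x, y, hxy⟩ := exists_ff_mul_lev A p.1 hb u
        rw [hxy, add_mul, mul_assoc]
        exact add_mem (lev_mul_mem_factored A b x (mul_mem (ff_mem_levSub A _ hQ) hz))
          (lev_mul_mem_factored A b y hz)
    exact h2 h1

/-! ### The bilinear form -/

/-- The data defining the normalized bilinear form on the bosonic extension. -/
structure BosonicForm (A : GCM I) (M : hA A →ₗ[𝕂] 𝕂) (Dm : hA A ≃ₐ[𝕂] hA A)
    (pairB : hA A →ₗ[𝕂] hA A →ₗ[𝕂] 𝕂) : Prop where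
  map_one : M 1 = 1
  map_eq_zero : ∀ (m : ℤ) (β : I →₀ ℤ), β ≠ 0 → ∀ y, y ∈ hAk A m → y ∈ hAwt A β →
    ∀ u ∈ hAgt A m, ∀ v ∈ hAlt A m, M (u * y * v) = 0
  shift : ∀ i p, Dm (ff A i p) = ff A i (p + 1)
  pair : ∀ (β : I →₀ ℤ) (x y : hA A), x ∈ hAwt A β →
    pairB x y = sqv ^ (-(ip A β β)) * M (x * Dm y)

namespace BosonicForm

variable {A : GCM I} {M : hA A →ₗ[𝕂] 𝕂} {Dm : hA A ≃ₐ[𝕂] hA A}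
  {pairB : hA A →ₗ[𝕂] hA A →ₗ[𝕂] 𝕂}

lemma map_lev_mul_of_lt (hB : BosonicForm A M Dm pairB) (b : ℤ) {w : List I} (hw : w ≠ [])
    {z : hA A} (hz : z ∈ hAlt A b) : M (lev A b (sg w) * z) = 0 := by
  have h := hB.map_eq_zero b (monWt (atLevel b w)) ?_ (lev A b (sg w)) (lev_mem_hAk A b _)
    (by rw [← mon_atLevel]; exact mon_mem_hAwt A _) 1 (one_mem _) z hz
  · rwa [one_mul] at h
  · intro h0
    rw [monWt_atLevel, smul_eq_zero] at h0
    have h1 := h0.resolve_left (Units.ne_zero _)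
    have h2 := height_wordWt w
    rw [h1, height_zero] at h2
    exact hw (List.length_eq_zero_iff.mp (by omega))

lemma map_lev_mul (hB : BosonicForm A M Dm pairB) (b : ℤ) {w : List I} (hw : w ≠ [])
    {z : hA A} (hz : z ∈ hAle A b) : M (lev A b (sg w) * z) = 0 := by
  have h1 := levSub_le_factored A (P := (· ≤ b)) (Q := (· < b)) (b := b)
    (fun k hk => (eq_or_lt_of_le hk).imp_right fun h => ⟨h, h⟩) hz
  have h2 : factored A b (levSub A (· < b)) ≤
      LinearMap.ker (M ∘ₗ LinearMap.mulLeft 𝕂 (lev A b (sg w))) := by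
    refine Submodule.span_le.mpr ?_
    rintro _ ⟨u, z, hz, rfl⟩
    rw [SetLike.mem_coe, LinearMap.mem_ker, LinearMap.comp_apply, LinearMap.mulLeft_apply,
      ← mul_assoc, ← lev_append]
    refine hB.map_lev_mul_of_lt b (by simp [hw]) ?_
    rwa [hAlt_eq]
  exact h2 h1

lemma map_mul_of_mem (hB : BosonicForm A M Dm pairB) (b : ℤ) {x y z : hA A} (hx : x ∈ hAk A b)
    (hy : y ∈ hAk A (b + 1)) (hz : z ∈ hAle A b) : M (x * y * z) = M (x * y) * M z := by
  have h1 : x * y ∈ factored A (b + 1) (levSub A (· = b)) := by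
    refine levSub_le_factored A (P := fun k => k = b ∨ k = b + 1) (fun k hk => ?_) (mul_mem ?_ ?_)
    · rcases hk with rfl | rfl
      · exact Or.inr ⟨lt_add_one _, rfl⟩
      · exact Or.inl rfl
    · rw [hAk_eq] at hx
      exact levSub_mono A (fun k hk => Or.inl hk) hx
    · rw [hAk_eq] at hy
      exact levSub_mono A (fun k hk => Or.inr hk) hy
  have h2 : factored A (b + 1) (levSub A (· = b)) ≤
      LinearMap.ker (M ∘ₗ LinearMap.mulRight 𝕂 z - M z • M) := by
    refine Submodule.span_le.mpr ?_
    rintro _ ⟨v, t, ht, rfl⟩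
    rw [← hAk_eq] at ht
    obtain ⟨t, rfl⟩ := exists_lev_eq A b ht
    rw [SetLike.mem_coe, LinearMap.mem_ker, LinearMap.sub_apply, LinearMap.comp_apply,
      LinearMap.mulRight_apply, LinearMap.smul_apply, smul_eq_mul]
    have hle : ∀ s, lev A b s ∈ hAle A b := fun s => by
      have := lev_mem_hAk A b s
      rw [hAk_eq] at this
      exact levSub_mono A (fun k hk => le_of_eq hk) this
    have hup : hAle A b ≤ hAle A (b + 1) := levSub_mono A fun k hk => by omega
    by_cases hv : v = []
    · subst hv
      rw [lev_nil, one_mul]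
      refine word_ext_apply (M ∘ₗ LinearMap.mulRight 𝕂 z ∘ₗ lev A b - M z • M ∘ₗ lev A b) 0
        (fun u => ?_) t
      simp only [LinearMap.sub_apply, LinearMap.comp_apply, LinearMap.mulRight_apply,
        LinearMap.smul_apply, smul_eq_mul, LinearMap.zero_apply]
      by_cases hu : u = []
      · subst hu
        rw [lev_nil, one_mul, hB.map_one, mul_one, sub_self]
      · rw [hB.map_lev_mul b hu hz, ← mul_one (lev A b (sg u)), hB.map_lev_mul b hu (one_mem _),
          mul_zero, sub_zero]
    · rw [mul_assoc, hB.map_lev_mul (b + 1) hv (hup (mul_mem (hle t) hz)),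
        hB.map_lev_mul (b + 1) hv (hup (hle t)), mul_zero, sub_zero]
  have h3 := h2 h1
  rw [LinearMap.mem_ker, LinearMap.sub_apply, sub_eq_zero] at h3
  exact h3.trans (mul_comm _ _)

lemma map_lev (hB : BosonicForm A M Dm pairB) (m : ℤ) (x : WordSpace I) :
    M (lev A m x) = counitW x := by
  refine word_ext_apply (M ∘ₗ lev A m) counitW (fun w => ?_) x
  rw [LinearMap.comp_apply]
  cases w with
  | nil => rw [lev_nil, hB.map_one, counitW_nil]
  | cons j w =>
    rw [← mul_one (lev A m _), hB.map_lev_mul m (List.cons_ne_nil j w) (one_mem _), counitW_cons]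

lemma shift_lev (hB : BosonicForm A M Dm pairB) (m : ℤ) (x : WordSpace I) :
    Dm (lev A m x) = lev A (m + 1) x := by
  refine word_ext_apply (Dm.toAlgHom.toLinearMap ∘ₗ lev A m) (lev A (m + 1)) (fun w => ?_) x
  change Dm (lev A m (sg w)) = _
  induction w with
  | nil => rw [lev_nil, lev_nil, _root_.map_one]
  | cons j w ih => rw [lev_cons, lev_cons, map_mul, ih, hB.shift]

/-- The normalization factor of the form in weight `β`. -/
def _root_.normScale (A : GCM I) : (I →₀ ℤ) → 𝕂 := fun β => sqv ^ (-ip A β β)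

lemma pair_lev (hB : BosonicForm A M Dm pairB) (m : ℤ) (x : WordSpace I) (y : hA A) :
    pairB (lev A m x) y = M (lev A m (scaleW (normScale A) x) * Dm y) := by
  refine word_ext_apply (pairB.flip y ∘ₗ lev A m)
    (M ∘ₗ LinearMap.mulRight 𝕂 (Dm y) ∘ₗ lev A m ∘ₗ scaleW (normScale A)) (fun w => ?_) x
  simp only [LinearMap.comp_apply, LinearMap.flip_apply, LinearMap.mulRight_apply]
  have h : lev A m (sg w) ∈ hAwt A (monWt (atLevel m w)) := by
    rw [← mon_atLevel]
    exact mon_mem_hAwt A _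
  rw [hB.pair _ _ y h, scaleW_sg, map_smul, smul_mul_assoc, map_smul, smul_eq_mul, normScale,
    monWt_atLevel, ip_smul_left, ip_smul_right, ← mul_assoc, ← Units.val_mul, Int.units_mul_self,
    Units.val_one, one_mul]

lemma _root_.normScale_sub (A : GCM I) (i : I) (β : I →₀ ℤ) :
    qh ^ ip A (simpleRoot i) (β - simpleRoot i) * normScale A β =
      sqv ^ (-(2 * A.d i)) * normScale A (β - simpleRoot i) := by
  rw [normScale, normScale, qh_zpow, ← zpow_add₀ sqv_ne_zero, ← zpow_add₀ sqv_ne_zero]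
  congr 1
  simp only [ip_sub_left, ip_sub_right, ip_simpleRoot_self, ip_symm A β (simpleRoot i)]
  ring

lemma pair_lev_cons (hB : BosonicForm A M Dm pairB) (m : ℤ) (x : WordSpace I) (i : I)
    (w : List I) :
    pairB (lev A m x) (lev A m (sg (i :: w))) =
      sqv ^ (-(2 * A.d i)) * (1 - qd A i ^ 2) * pairB (lev A m (lder A i x)) (lev A m (sg w)) := by
  have h1 : torusW A i (lder A i (scaleW (normScale A) x)) =
      sqv ^ (-(2 * A.d i)) • scaleW (normScale A) (lder A i x) := by
    rw [torusW, scaleW_lder, scaleW_lder, scaleW_scaleW, ← map_smul, ← scaleW_smul]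
    congr 3
    funext β
    exact normScale_sub A i β
  have h2 : ∀ z, M (ff A i (m + 1) * lev A m z * lev A (m + 1) (sg w)) = 0 := by
    intro z
    have h3 : ff A i (m + 1) = lev A (m + 1) (sg [i]) := by rw [lev_cons, lev_nil, mul_one]
    rw [h3, mul_assoc]
    refine hB.map_lev_mul (m + 1) (List.cons_ne_nil i []) (mul_mem ?_ ?_)
    · have := lev_mem_hAk A m z
      rw [hAk_eq] at this
      exact levSub_mono A (fun k hk => by omega) this
    · have := lev_mem_hAk A (m + 1) (sg w)
      rw [hAk_eq] at this
      exact levSub_mono A (fun k hk => by omega) this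
  rw [hB.pair_lev, hB.pair_lev, lev_cons, map_mul Dm, hB.shift, ← mul_assoc, lev_mul_ff, add_mul,
    map_add, hB.shift_lev, h2, zero_add, h1, map_smul, smul_mul_assoc, smul_mul_assoc, map_smul,
    map_smul, smul_eq_mul, smul_eq_mul]
  ring

/-- The norm factor of a word. -/
def _root_.wordNorm (A : GCM I) (w : List I) : 𝕂 :=
  (w.map fun i => sqv ^ (-(2 * A.d i)) * (1 - qd A i ^ 2)).prod

lemma _root_.wordNorm_ne_zero (A : GCM I) (w : List I) : wordNorm A w ≠ 0 := by
  rw [wordNorm]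
  refine List.prod_ne_zero fun h => ?_
  obtain ⟨i, _, hi⟩ := List.mem_map.mp h
  exact mul_ne_zero (zpow_ne_zero _ sqv_ne_zero) (zi_ne_zero A i) hi

lemma pair_lev_word (hB : BosonicForm A M Dm pairB) (m : ℤ) (x : WordSpace I) (w : List I) :
    pairB (lev A m x) (lev A m (sg w)) = wordNorm A w * wordPair A w x := by
  induction w generalizing x with
  | nil =>
    rw [hB.pair_lev, lev_nil, _root_.map_one, mul_one, hB.map_lev, ← wordPair_nil A,
      wordPair_scaleW, wordPair_nil]
    simp [normScale, wordWt_nil, ip_zero_left, wordNorm]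
  | cons i w ih =>
    rw [hB.pair_lev_cons, ih, wordPair_cons, wordNorm, wordNorm, List.map_cons, List.prod_cons]
    ring

lemma pair_lev_symm (hB : BosonicForm A M Dm pairB) (m : ℤ) (x y : WordSpace I) :
    pairB (lev A m x) (lev A m y) = pairB (lev A m y) (lev A m x) := by
  have h : ∀ v w : List I, pairB (lev A m (sg v)) (lev A m (sg w)) =
      pairB (lev A m (sg w)) (lev A m (sg v)) := by
    intro v w
    rw [hB.pair_lev_word, hB.pair_lev_word, wordPair_symm A v w]
    by_cases hvw : wordWt v = wordWt w
    · congr 1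
      exact ((perm_of_wordWt_eq hvw).symm.map _).prod_eq
    · rw [wordPair_eq_zero A (Ne.symm hvw), mul_zero, mul_zero]
  refine word_ext_apply (pairB.flip (lev A m y) ∘ₗ lev A m) (pairB (lev A m y) ∘ₗ lev A m)
    (fun v => ?_) x
  exact word_ext_apply (pairB (lev A m (sg v)) ∘ₗ lev A m) (pairB.flip (lev A m (sg v)) ∘ₗ lev A m)
    (fun w => h v w) y

lemma pair_hAk_symm (hB : BosonicForm A M Dm pairB) (m : ℤ) {x y : hA A} (hx : x ∈ hAk A m)
    (hy : y ∈ hAk A m) : pairB x y = pairB y x := by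
  obtain ⟨x, rfl⟩ := exists_lev_eq A m hx
  obtain ⟨y, rfl⟩ := exists_lev_eq A m hy
  exact hB.pair_lev_symm m x y

lemma eq_zero_of_pair_hAk (hB : BosonicForm A M Dm pairB) (m : ℤ) {x : hA A} (hx : x ∈ hAk A m)
    (h : ∀ y ∈ hAk A m, pairB x y = 0) : x = 0 := by
  obtain ⟨x, rfl⟩ := exists_lev_eq A m hx
  refine lev_eq_zero A m fun w => ?_
  have h1 := h _ (lev_mem_hAk A m (sg w))
  rw [hB.pair_lev_word] at h1
  exact (mul_eq_zero.mp h1).resolve_left (wordNorm_ne_zero A w)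

lemma shift_mem (hB : BosonicForm A M Dm pairB) {b : ℤ} {y : hA A} (hy : y ∈ hAlt A b) :
    Dm y ∈ hAle A b := by
  rw [hAlt_eq, levSub] at hy
  have h : Dm.toAlgHom y ∈ (Algebra.adjoin 𝕂 _).map Dm.toAlgHom :=
    Subalgebra.mem_map.mpr ⟨y, hy, rfl⟩
  rw [AlgHom.map_adjoin] at h
  refine Algebra.adjoin_mono ?_ h
  rintro _ ⟨_, ⟨i, k, hk, rfl⟩, rfl⟩
  exact ⟨i, k + 1, by omega, hB.shift i k⟩

lemma pair_mon_mul (hB : BosonicForm A M Dm pairB) (b : ℤ) (u v : List I) (l : List (I × ℤ))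
    (hl : ∀ p ∈ l, p.2 < b) {Y : hA A} (hY : Y ∈ hAlt A b) :
    pairB (lev A b (sg u) * mon A l) (lev A b (sg v) * Y) =
      pairB (lev A b (sg u)) (lev A b (sg v)) * pairB (mon A l) Y := by
  have hX : mon A l ∈ hAle A b := mon_mem_levSub A l fun p hp => (hl p hp).le
  have hu : lev A b (sg u) = mon A (atLevel b u) := (mon_atLevel A b u).symm
  have hwt : lev A b (sg u) * mon A l ∈ hAwt A (monWt (atLevel b u ++ l)) := by
    rw [hu, ← mon_append]
    exact mon_mem_hAwt A _
  have hwu : lev A b (sg u) ∈ hAwt A (monWt (atLevel b u)) := by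
    rw [hu]
    exact mon_mem_hAwt A _
  have hcomm : mon A l * lev A (b + 1) (sg v) =
      qh ^ (-ip A (monWt l) (monWt (atLevel (b + 1) v))) • (lev A (b + 1) (sg v) * mon A l) := by
    rw [← mon_atLevel]
    refine mon_mul_mon_far A l _ fun p hp p' hp' => ?_
    obtain ⟨j, _, rfl⟩ := List.mem_map.mp hp'
    have := hl p hp
    change p.2 + 1 < b + 1
    omega
  have hM : M (lev A b (sg u) * mon A l * Dm (lev A b (sg v) * Y)) =
      qh ^ (-ip A (monWt l) (monWt (atLevel (b + 1) v))) *
        (M (lev A b (sg u) * Dm (lev A b (sg v))) * M (mon A l * Dm Y)) := by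
    rw [map_mul Dm, hB.shift_lev, ← mul_assoc, mul_assoc (lev A b (sg u)), hcomm, mul_smul_comm,
      smul_mul_assoc, map_smul, smul_eq_mul, ← mul_assoc, mul_assoc _ (mon A l),
      hB.map_mul_of_mem b (lev_mem_hAk A b _) (lev_mem_hAk A (b + 1) _)
        (mul_mem hX (hB.shift_mem hY))]
  by_cases huv : wordWt u = wordWt v
  · rw [hB.pair _ _ _ hwt, hB.pair _ _ _ hwu, hB.pair _ _ _ (mon_mem_hAwt A l), hM]
    have h1 : sqv ^ (-ip A (monWt (atLevel b u ++ l)) (monWt (atLevel b u ++ l))) *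
        qh ^ (-ip A (monWt l) (monWt (atLevel (b + 1) v))) =
        sqv ^ (-ip A (monWt (atLevel b u)) (monWt (atLevel b u))) *
          sqv ^ (-ip A (monWt l) (monWt l)) := by
      have h2 : monWt (atLevel (b + 1) v) = -monWt (atLevel b u) := by
        rw [monWt_atLevel, monWt_atLevel, huv, Int.negOnePow_succ (b + 1), Units.val_neg, neg_smul]
      rw [qh_zpow, ← zpow_add₀ sqv_ne_zero, ← zpow_add₀ sqv_ne_zero, h2, monWt_append]
      congr 1
      simp only [ip_add_left, ip_add_right, ip_neg_right, ip_symm A (monWt l) (monWt (atLevel b u))]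
      ring
    rw [← mul_assoc, h1]
    ring
  · have h0 : pairB (lev A b (sg u)) (lev A b (sg v)) = 0 := by
      rw [hB.pair_lev_word, wordPair_eq_zero A (Ne.symm huv), mul_zero]
    have h1 := h0
    rw [hB.pair _ _ _ hwu, mul_eq_zero] at h1
    rw [h0, zero_mul, hB.pair _ _ _ hwt, hM,
      h1.resolve_left (zpow_ne_zero _ sqv_ne_zero), zero_mul, mul_zero, mul_zero]

lemma pair_mul (hB : BosonicForm A M Dm pairB) (b : ℤ) {x y X Y : hA A} (hx : x ∈ hAk A b)
    (hy : y ∈ hAk A b) (hX : X ∈ hAlt A b) (hY : Y ∈ hAlt A b) :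
    pairB (x * X) (y * Y) = pairB x y * pairB X Y := by
  obtain ⟨x, rfl⟩ := exists_lev_eq A b hx
  obtain ⟨y, rfl⟩ := exists_lev_eq A b hy
  rw [hAlt_eq, mem_levSub_iff] at hX
  induction hX using Submodule.span_induction with
  | zero => simp
  | add X X' _ _ h h' =>
    rw [mul_add, map_add, map_add, LinearMap.add_apply, LinearMap.add_apply, h, h', mul_add]
  | smul c X _ h =>
    rw [mul_smul_comm, map_smul, map_smul, LinearMap.smul_apply, LinearMap.smul_apply, h,
      smul_eq_mul, smul_eq_mul, mul_left_comm]
  | mem X hX =>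
    obtain ⟨l, hl, rfl⟩ := hX
    refine word_ext_apply (pairB.flip (lev A b y * Y) ∘ₗ LinearMap.mulRight 𝕂 (mon A l) ∘ₗ lev A b)
      (pairB (mon A l) Y • pairB.flip (lev A b y) ∘ₗ lev A b) (fun u => ?_) x |>.trans
        (mul_comm _ _)
    refine word_ext_apply (pairB (lev A b (sg u) * mon A l) ∘ₗ LinearMap.mulRight 𝕂 Y ∘ₗ lev A b)
      (pairB (mon A l) Y • pairB (lev A b (sg u)) ∘ₗ lev A b) (fun v => ?_) y
    exact (hB.pair_mon_mul b u v l hl hY).trans (mul_comm _ _)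

end BosonicForm

/-! ### Symmetry, non-degeneracy and multiplicativity -/

/-- If a form is multiplicative on products from `S` and `T` and non-degenerate on `S` and on `T`,
then it is non-degenerate on `S * T`. -/
lemma eq_zero_of_mul_form {R : Type} [Ring R] [Algebra 𝕂 R] (p : R →ₗ[𝕂] R →ₗ[𝕂] 𝕂)
    {S T : Submodule 𝕂 R}
    (hmul : ∀ x ∈ S, ∀ y ∈ S, ∀ X ∈ T, ∀ Y ∈ T, p (x * X) (y * Y) = p x y * p X Y)
    (hS : ∀ x ∈ S, (∀ y ∈ S, p x y = 0) → x = 0) (hT : ∀ x ∈ T, (∀ y ∈ T, p x y = 0) → x = 0)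
    {x : R} (hx : x ∈ S * T) (h : ∀ y ∈ S, ∀ z ∈ T, p x (y * z) = 0) : x = 0 := by
  have hsurj : S * T ≤ LinearMap.range
      (LinearMap.mul' 𝕂 R ∘ₗ TensorProduct.map S.subtype T.subtype) :=
    Submodule.mul_le.mpr fun y hy z hz => ⟨⟨y, hy⟩ ⊗ₜ ⟨z, hz⟩, rfl⟩
  obtain ⟨t, rfl⟩ := hsurj hx
  have hpair : ∀ (y : S) (z : T) (t : S ⊗[𝕂] T),
      (p.flip z ∘ₗ T.subtype) (TensorProduct.lid 𝕂 T
        (TensorProduct.map (p.flip y ∘ₗ S.subtype) LinearMap.id t)) =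
      p ((LinearMap.mul' 𝕂 R ∘ₗ TensorProduct.map S.subtype T.subtype) t) (y * z) := by
    intro y z t
    induction t using TensorProduct.induction_on with
    | zero => simp only [map_zero, LinearMap.zero_apply]
    | add t t' h h' => rw [map_add, map_add, map_add, map_add, map_add, LinearMap.add_apply, h, h']
    | tmul y' z' =>
      rw [TensorProduct.map_tmul, TensorProduct.lid_tmul, map_smul, smul_eq_mul]
      exact (hmul _ y'.2 _ y.2 _ z'.2 _ z.2).symm
  have h0 : TensorProduct.map S.subtype T.subtype t = 0 := by
    refine tensor_map_eq_zero S.subtype T.subtype (fun y : S => p.flip y ∘ₗ S.subtype)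
      (fun z : T => p.flip z ∘ₗ T.subtype) (fun v hv => ?_) (fun v hv => ?_) t fun y z => ?_
    · exact hS v v.2 fun y hy => hv ⟨y, hy⟩
    · exact hT v v.2 fun y hy => hv ⟨y, hy⟩
    · rw [hpair]
      exact h y y.2 z z.2
  rw [LinearMap.comp_apply, h0, map_zero]

/-- The subalgebra generated by the `n` levels `b - n + 1, …, b`. -/
def window (A : GCM I) (b : ℤ) (n : ℕ) : Subalgebra 𝕂 (hA A) :=
  levSub A fun k => b - n < k ∧ k ≤ b

lemma window_zero (A : GCM I) {b : ℤ} {x : hA A} (hx : x ∈ window A b 0) :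
    ∃ c : 𝕂, x = c • 1 := by
  rw [window, mem_levSub_iff] at hx
  induction hx using Submodule.span_induction with
  | zero => exact ⟨0, (zero_smul _ _).symm⟩
  | add x y _ _ hx hy =>
    obtain ⟨c, rfl⟩ := hx
    obtain ⟨c', rfl⟩ := hy
    exact ⟨c + c', (add_smul _ _ _).symm⟩
  | smul c x _ hx =>
    obtain ⟨c', rfl⟩ := hx
    exact ⟨c * c', smul_smul _ _ _⟩
  | mem x hx =>
    obtain ⟨l, hl, rfl⟩ := hx
    cases l with
    | nil => exact ⟨1, by rw [mon_nil, one_smul]⟩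
    | cons p l =>
      have := hl p List.mem_cons_self
      push_cast at this
      omega

lemma window_succ_le_factored (A : GCM I) {b : ℤ} {n : ℕ} {x : hA A}
    (hx : x ∈ window A b (n + 1)) : x ∈ factored A b (window A (b - 1) n) := by
  refine levSub_le_factored A (fun k hk => ?_) hx
  push_cast at hk
  omega

lemma window_le_hAlt (A : GCM I) (b : ℤ) (n : ℕ) : window A (b - 1) n ≤ hAlt A b := by
  rw [hAlt_eq]
  exact levSub_mono A fun k hk => by omega

lemma mul_mem_window (A : GCM I) {b : ℤ} {n : ℕ} {y z : hA A} (hy : y ∈ hAk A b)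
    (hz : z ∈ window A (b - 1) n) : y * z ∈ window A b (n + 1) := by
  rw [hAk_eq] at hy
  exact mul_mem (levSub_mono A (fun k hk => by push_cast; omega) hy)
    (levSub_mono A (fun k hk => by push_cast; omega) hz)

lemma window_mono (A : GCM I) {m n : ℕ} (h : m ≤ n) :
    window A m (2 * m + 1) ≤ window A n (2 * n + 1) :=
  levSub_mono A fun k hk => by push_cast at hk ⊢; omega

lemma exists_mem_window (A : GCM I) (x : hA A) : ∃ n : ℕ, x ∈ window A n (2 * n + 1) := by
  obtain ⟨x, rfl⟩ := RingQuot.mkAlgHom_surjective 𝕂 (hARel A) x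
  induction x using FreeAlgebra.induction with
  | grade0 r => exact ⟨0, by rw [AlgHom.commutes]; exact Subalgebra.algebraMap_mem _ r⟩
  | grade1 p =>
    refine ⟨p.2.natAbs, ff_mem_levSub A p.1 ?_⟩
    constructor <;> omega
  | mul x y hx hy =>
    obtain ⟨m, hm⟩ := hx
    obtain ⟨n, hn⟩ := hy
    exact ⟨max m n, by
      rw [map_mul]
      exact mul_mem (window_mono A (le_max_left m n) hm) (window_mono A (le_max_right m n) hn)⟩
  | add x y hx hy =>
    obtain ⟨m, hm⟩ := hx
    obtain ⟨n, hn⟩ := hy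
    exact ⟨max m n, by
      rw [map_add]
      exact add_mem (window_mono A (le_max_left m n) hm) (window_mono A (le_max_right m n) hn)⟩

namespace BosonicForm

variable {A : GCM I} {M : hA A →ₗ[𝕂] 𝕂} {Dm : hA A ≃ₐ[𝕂] hA A}
  {pairB : hA A →ₗ[𝕂] hA A →ₗ[𝕂] 𝕂}

lemma pair_one_one (hB : BosonicForm A M Dm pairB) : pairB 1 1 = 1 := by
  rw [← mon_nil, hB.pair _ _ _ (mon_mem_hAwt A []), mon_nil, _root_.map_one, mul_one, hB.map_one]
  simp [monWt, ip_zero_left]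

lemma pair_window_symm (hB : BosonicForm A M Dm pairB) {b : ℤ} {n : ℕ} {x y : hA A}
    (hx : x ∈ window A b n) (hy : y ∈ window A b n) : pairB x y = pairB y x := by
  induction n generalizing b x y with
  | zero =>
    obtain ⟨c, rfl⟩ := window_zero A hx
    obtain ⟨c', rfl⟩ := window_zero A hy
    simp only [map_smul, LinearMap.smul_apply, smul_eq_mul]
    ring
  | succ n ih =>
    have h : ∀ u v, ∀ z ∈ window A (b - 1) n, ∀ z' ∈ window A (b - 1) n,
        pairB (lev A b (sg u) * z) (lev A b (sg v) * z') =
          pairB (lev A b (sg v) * z') (lev A b (sg u) * z) := by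
      intro u v z hz z' hz'
      have hu := lev_mem_hAk A b (sg u)
      have hv := lev_mem_hAk A b (sg v)
      have hlt := window_le_hAlt A b n
      rw [hB.pair_mul b hu hv (hlt hz) (hlt hz'), hB.pair_mul b hv hu (hlt hz') (hlt hz),
        hB.pair_hAk_symm b hu hv, ih hz hz']
    have hx' := window_succ_le_factored A hx
    have hy' := window_succ_le_factored A hy
    rw [factored] at hx' hy'
    suffices hs : x ∈ LinearMap.ker (pairB.flip y - pairB y) from
      sub_eq_zero.mp (LinearMap.mem_ker.mp hs)
    refine Submodule.span_le.mpr ?_ hx'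
    rintro _ ⟨u, z, hz, rfl⟩
    suffices hs : y ∈ LinearMap.ker (pairB (lev A b (sg u) * z) -
        pairB.flip (lev A b (sg u) * z)) from hs
    refine Submodule.span_le.mpr ?_ hy'
    rintro _ ⟨v, z', hz', rfl⟩
    exact sub_eq_zero.mpr (h u v z hz z' hz')

lemma pair_symm (hB : BosonicForm A M Dm pairB) (x y : hA A) : pairB x y = pairB y x := by
  obtain ⟨m, hm⟩ := exists_mem_window A x
  obtain ⟨n, hn⟩ := exists_mem_window A y
  exact hB.pair_window_symm (window_mono A (le_max_left m n) hm)
    (window_mono A (le_max_right m n) hn)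

lemma eq_zero_of_pair_window (hB : BosonicForm A M Dm pairB) {b : ℤ} {n : ℕ} {x : hA A}
    (hx : x ∈ window A b n) (h : ∀ y ∈ window A b n, pairB x y = 0) : x = 0 := by
  induction n generalizing b x with
  | zero =>
    obtain ⟨c, rfl⟩ := window_zero A hx
    have h1 := h 1 (one_mem _)
    rw [map_smul, LinearMap.smul_apply, hB.pair_one_one, smul_eq_mul, mul_one] at h1
    rw [h1, zero_smul]
  | succ n ih =>
    have hlt := window_le_hAlt A b n
    refine eq_zero_of_mul_form pairB (S := (hAk A b).toSubmodule)
      (T := (window A (b - 1) n).toSubmodule)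
      (fun x hx y hy X hX Y hY => hB.pair_mul b hx hy (hlt hX) (hlt hY))
      (fun x hx hy => hB.eq_zero_of_pair_hAk b hx hy) (fun x hx hy => ih hx hy) ?_
      (fun y hy z hz => h _ (mul_mem_window A hy hz))
    refine Submodule.span_le.mpr ?_ (window_succ_le_factored A hx)
    rintro _ ⟨u, z, hz, rfl⟩
    exact Submodule.mul_mem_mul (lev_mem_hAk A b _) hz

lemma eq_zero_of_pair (hB : BosonicForm A M Dm pairB) {x : hA A} (h : ∀ y, pairB x y = 0) :
    x = 0 := by
  obtain ⟨n, hn⟩ := exists_mem_window A x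
  exact hB.eq_zero_of_pair_window hn fun y _ => h y

lemma _root_.ofFn_prod_mem_window (A : GCM I) {b : ℤ} {n : ℕ} {xs : Fin n → hA A}
    (hx : ∀ k : Fin n, xs k ∈ hAk A (b - (k : ℕ))) : (List.ofFn xs).prod ∈ window A b n := by
  refine Subalgebra.list_prod_mem _ fun x h => ?_
  obtain ⟨k, rfl⟩ := List.mem_ofFn.mp h
  have h1 := hx k
  rw [hAk_eq] at h1
  exact levSub_mono A (fun p hp => by have := k.2; omega) h1

lemma pair_ofFn_prod (hB : BosonicForm A M Dm pairB) {b : ℤ} {n : ℕ} (xs ys : Fin n → hA A)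
    (hx : ∀ k : Fin n, xs k ∈ hAk A (b - (k : ℕ)))
    (hy : ∀ k : Fin n, ys k ∈ hAk A (b - (k : ℕ))) :
    pairB (List.ofFn xs).prod (List.ofFn ys).prod = ∏ k, pairB (xs k) (ys k) := by
  induction n generalizing b with
  | zero => simpa using hB.pair_one_one
  | succ n ih =>
    have htail : ∀ zs : Fin (n + 1) → hA A, (∀ k : Fin (n + 1), zs k ∈ hAk A (b - (k : ℕ))) →
        ∀ k : Fin n, zs k.succ ∈ hAk A (b - 1 - (k : ℕ)) := by
      intro zs hz k
      have h1 := hz k.succ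
      rwa [Fin.val_succ, Nat.cast_succ, show b - ((k : ℕ) + 1 : ℤ) = b - 1 - (k : ℕ) by ring] at h1
    have hhead : ∀ zs : Fin (n + 1) → hA A, (∀ k : Fin (n + 1), zs k ∈ hAk A (b - (k : ℕ))) →
        zs 0 ∈ hAk A b := by
      intro zs hz
      simpa using hz 0
    rw [List.ofFn_succ, List.ofFn_succ, List.prod_cons, List.prod_cons, Fin.prod_univ_succ,
      hB.pair_mul b (hhead xs hx) (hhead ys hy)
        (window_le_hAlt A b n (ofFn_prod_mem_window A (htail xs hx)))
        (window_le_hAlt A b n (ofFn_prod_mem_window A (htail ys hy))),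
      ih _ _ (htail xs hx) (htail ys hy)]

end BosonicForm

/-! ### Comparison with the form on the quantum coordinate ring -/

lemma word_mem_Uwt (A : GCM I) (w : List I) : evalW (fg A) (sg w) ∈ Uwt A (-wordWt w) :=
  Submodule.subset_span ⟨w, rfl, evalW_sg _ w⟩

lemma exists_evalW_fg (A : GCM I) (u : Uq A) : ∃ x, u = evalW (fg A) x := by
  obtain ⟨u, rfl⟩ := RingQuot.mkAlgHom_surjective 𝕂 (URel A) u
  have h : ∀ x y, ∃ z, evalW (fg A) x * evalW (fg A) y = evalW (fg A) z := by
    intro x y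
    induction x using word_induction with
    | h0 => exact ⟨0, by rw [map_zero, zero_mul]⟩
    | hadd x x' hx hx' =>
      obtain ⟨z, hz⟩ := hx
      obtain ⟨z', hz'⟩ := hx'
      exact ⟨z + z', by rw [map_add, add_mul, hz, hz', map_add]⟩
    | hsmul c x hx =>
      obtain ⟨z, hz⟩ := hx
      exact ⟨c • z, by rw [map_smul, smul_mul_assoc, hz, map_smul]⟩
    | hw w =>
      induction w with
      | nil => exact ⟨y, by rw [evalW_nil, one_mul]⟩
      | cons j w ih =>
        obtain ⟨z, hz⟩ := ih
        exact ⟨lmulW j z, by rw [← lmulW_sg, evalW_lmulW, mul_assoc, hz, evalW_lmulW]⟩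
  induction u using FreeAlgebra.induction with
  | grade0 r =>
    exact ⟨r • sg [], by rw [AlgHom.commutes, map_smul, evalW_nil, Algebra.algebraMap_eq_smul_one]⟩
  | grade1 i => exact ⟨sg [i], by rw [evalW_sg, List.map_singleton, List.prod_singleton]; rfl⟩
  | mul u v hu hv =>
    obtain ⟨x, hx⟩ := hu
    obtain ⟨y, hy⟩ := hv
    obtain ⟨z, hz⟩ := h x y
    exact ⟨z, by rw [map_mul, hx, hy, hz]⟩
  | add u v hu hv =>
    obtain ⟨x, hx⟩ := hu
    obtain ⟨y, hy⟩ := hv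
    exact ⟨x + y, by rw [map_add, hx, hy, map_add]⟩

/-- Contraction of the left tensor factor with a functional. -/
def contract (A : GCM I) (h : Uq A →ₗ[𝕂] 𝕂) : Uq A ⊗[𝕂] Uq A →ₗ[𝕂] Uq A :=
  TensorProduct.lift (LinearMap.lsmul 𝕂 (Uq A) ∘ₗ h)

lemma contract_tmul (A : GCM I) (h : Uq A →ₗ[𝕂] 𝕂) (x y : Uq A) :
    contract A h (x ⊗ₜ y) = h x • y := rfl

lemma pairT_eq_contract (A : GCM I) (f g : Uq A →ₗ[𝕂] 𝕂) (t : Uq A ⊗[𝕂] Uq A) :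
    pairT A f g t = g (contract A f t) := by
  induction t using TensorProduct.induction_on with
  | zero => rw [map_zero, map_zero, map_zero]
  | add t t' h h' => rw [map_add, map_add, map_add, h, h']
  | tmul x y =>
    rw [contract_tmul, map_smul, smul_eq_mul]
    rfl

/-- A form on `U` for which multiplication is dual to the twisted coproduct. -/
structure DualForm (A : GCM I)
    (mu2 : Uq A ⊗[𝕂] Uq A →ₗ[𝕂] Uq A ⊗[𝕂] Uq A →ₗ[𝕂] Uq A ⊗[𝕂] Uq A)
    (Δ : Uq A →ₗ[𝕂] Uq A ⊗[𝕂] Uq A) (E : Uq A →ₗ[𝕂] Uq A →ₗ[𝕂] 𝕂) : Prop where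
  mu2_tmul : ∀ β' γ x y x' y', x' ∈ Uwt A β' → y ∈ Uwt A γ →
    mu2 (x ⊗ₜ[𝕂] y) (x' ⊗ₜ[𝕂] y') = qh ^ (-(ip A β' γ)) • ((x * x') ⊗ₜ[𝕂] (y * y'))
  coprod_one : Δ 1 = 1 ⊗ₜ[𝕂] 1
  coprod_gen : ∀ i, Δ (fg A i) = fg A i ⊗ₜ[𝕂] 1 + 1 ⊗ₜ[𝕂] fg A i
  coprod_mul : ∀ x y, Δ (x * y) = mu2 (Δ x) (Δ y)
  gen : ∀ i j, E (fg A i) (fg A j) = if i = j then ((1 : 𝕂) - qd A i ^ 2)⁻¹ else 0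
  one : E 1 1 = 1
  mul : ∀ x y u, E (x * y) u = pairT A (E x) (E y) (Δ u)
  weight : ∀ β γ u v, β ≠ γ → u ∈ Uwt A β → v ∈ Uwt A γ → E u v = 0

namespace DualForm

variable {A : GCM I} {mu2 : Uq A ⊗[𝕂] Uq A →ₗ[𝕂] Uq A ⊗[𝕂] Uq A →ₗ[𝕂] Uq A ⊗[𝕂] Uq A}
  {Δ : Uq A →ₗ[𝕂] Uq A ⊗[𝕂] Uq A} {E : Uq A →ₗ[𝕂] Uq A →ₗ[𝕂] 𝕂}

lemma apply_word_eq_zero (hE : DualForm A mu2 Δ E) {v w : List I} (h : wordWt v ≠ wordWt w) :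
    E (evalW (fg A) (sg v)) (evalW (fg A) (sg w)) = 0 :=
  hE.weight _ _ _ _ (fun h' => h (neg_injective h')) (word_mem_Uwt A v) (word_mem_Uwt A w)

lemma one_apply (hE : DualForm A mu2 Δ E) (x : WordSpace I) :
    E 1 (evalW (fg A) x) = counitW x := by
  refine word_ext_apply (E 1 ∘ₗ evalW (fg A)) counitW (fun w => ?_) x
  rw [LinearMap.comp_apply]
  cases w with
  | nil => rw [evalW_nil, hE.one, counitW_nil]
  | cons j w =>
    rw [counitW_cons, ← evalW_nil (fg A)]
    refine hE.apply_word_eq_zero fun h => ?_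
    simpa using (perm_of_wordWt_eq h).length_eq

lemma gen_apply_of_ne (hE : DualForm A mu2 Δ E) {i : I} {w : List I} (h : w ≠ [i]) :
    E (fg A i) (evalW (fg A) (sg w)) = 0 := by
  have h1 : fg A i = evalW (fg A) (sg [i]) := by
    rw [evalW_sg, List.map_singleton, List.prod_singleton]
  rw [h1]
  exact hE.apply_word_eq_zero fun h' => h (List.perm_singleton.mp (perm_of_wordWt_eq h').symm)

lemma mu2_coprod_gen (hE : DualForm A mu2 Δ E) (j : I) (w : List I) (y : Uq A) :
    mu2 (Δ (fg A j)) (evalW (fg A) (sg w) ⊗ₜ y) =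
      evalW (fg A) (sg (j :: w)) ⊗ₜ y + qh ^ (-ip A (wordWt w) (simpleRoot j)) •
        (evalW (fg A) (sg w) ⊗ₜ (fg A j * y)) := by
  have h1 : (1 : Uq A) ∈ Uwt A 0 := by
    have := word_mem_Uwt A []
    rwa [wordWt_nil, neg_zero, evalW_nil] at this
  have h2 : fg A j ∈ Uwt A (-simpleRoot j) := by
    have := word_mem_Uwt A [j]
    rwa [wordWt_cons, wordWt_nil, add_zero, evalW_sg, List.map_singleton,
      List.prod_singleton] at this
  rw [hE.coprod_gen, map_add, LinearMap.add_apply,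
    hE.mu2_tmul _ _ _ _ _ y (word_mem_Uwt A w) h1, hE.mu2_tmul _ _ _ _ _ y (word_mem_Uwt A w) h2,
    ip_zero_right, neg_zero, zpow_zero, one_smul, one_mul, one_mul, ← evalW_lmulW, lmulW_sg,
    ip_neg_left, ip_neg_right, neg_neg]

lemma tensor_word_induction {P : Uq A ⊗[𝕂] Uq A → Prop} (h0 : P 0)
    (hadd : ∀ s t, P s → P t → P (s + t)) (hsmul : ∀ (c : 𝕂) t, P t → P (c • t))
    (hw : ∀ w y, P (evalW (fg A) (sg w) ⊗ₜ y)) (t : Uq A ⊗[𝕂] Uq A) : P t := by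
  induction t using TensorProduct.induction_on with
  | zero => exact h0
  | add s t hs ht => exact hadd s t hs ht
  | tmul x y =>
    obtain ⟨x, rfl⟩ := exists_evalW_fg A x
    induction x using word_induction with
    | h0 => rw [map_zero, TensorProduct.zero_tmul]; exact h0
    | hadd x x' hx hx' => rw [map_add, TensorProduct.add_tmul]; exact hadd _ _ hx hx'
    | hsmul c x hx => rw [map_smul, ← TensorProduct.smul_tmul']; exact hsmul c _ hx
    | hw w => exact hw w y

lemma contract_one_mu2 (hE : DualForm A mu2 Δ E) (j : I) (t : Uq A ⊗[𝕂] Uq A) :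
    contract A (E 1) (mu2 (Δ (fg A j)) t) = fg A j * contract A (E 1) t := by
  induction t using tensor_word_induction with
  | h0 => rw [map_zero, map_zero, mul_zero]
  | hadd s t hs ht => rw [map_add, map_add, map_add, hs, ht, mul_add]
  | hsmul c t ht => rw [map_smul, map_smul, map_smul, ht, mul_smul_comm]
  | hw w y =>
    rw [hE.mu2_coprod_gen, map_add, map_smul, contract_tmul, contract_tmul, contract_tmul,
      hE.one_apply, hE.one_apply, counitW_cons, zero_smul, zero_add]
    cases w with
    | nil => rw [wordWt_nil, ip_zero_left, neg_zero, zpow_zero, one_smul, mul_smul_comm]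
    | cons k w => rw [counitW_cons, zero_smul, zero_smul, smul_zero, mul_zero]

lemma contract_gen_mu2 (hE : DualForm A mu2 Δ E) (i j : I) (t : Uq A ⊗[𝕂] Uq A) :
    contract A (E (fg A i)) (mu2 (Δ (fg A j)) t) =
      (if i = j then ((1 : 𝕂) - qd A i ^ 2)⁻¹ • contract A (E 1) t else 0) +
        qh ^ (-ip A (simpleRoot i) (simpleRoot j)) • (fg A j * contract A (E (fg A i)) t) := by
  induction t using tensor_word_induction with
  | h0 => rw [map_zero, map_zero, map_zero, mul_zero, smul_zero, smul_zero, ite_self, add_zero]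
  | hadd s t hs ht =>
    rw [map_add, map_add, map_add, map_add, hs, ht, mul_add, smul_add, smul_add]
    split_ifs <;> abel
  | hsmul c t ht =>
    rw [map_smul, map_smul, map_smul, map_smul, ht, mul_smul_comm, smul_add, smul_ite, smul_zero,
      smul_comm c, smul_comm c]
  | hw w y =>
    rw [hE.mu2_coprod_gen, map_add, map_smul, contract_tmul, contract_tmul, contract_tmul,
      contract_tmul, hE.one_apply, mul_smul_comm]
    congr 1
    · cases w with
      | nil =>
        rw [evalW_sg, List.map_singleton, List.prod_singleton, hE.gen, counitW_nil, one_smul,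
          ite_smul, zero_smul]
      | cons k w =>
        rw [hE.gen_apply_of_ne fun h => by simp at h, counitW_cons, zero_smul, smul_zero, ite_self]
    · by_cases h : w = [i]
      · rw [h, wordWt_cons, wordWt_nil, add_zero]
      · rw [hE.gen_apply_of_ne h, zero_smul, smul_zero, smul_zero]

lemma contract_one_coprod (hE : DualForm A mu2 Δ E) (x : WordSpace I) :
    contract A (E 1) (Δ (evalW (fg A) x)) = evalW (fg A) x := by
  refine word_ext_apply (contract A (E 1) ∘ₗ Δ ∘ₗ evalW (fg A)) (evalW (fg A)) (fun w => ?_) x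
  rw [LinearMap.comp_apply, LinearMap.comp_apply]
  induction w with
  | nil => rw [evalW_nil, hE.coprod_one, contract_tmul, hE.one, one_smul]
  | cons j w ih => rw [← lmulW_sg, evalW_lmulW, hE.coprod_mul, hE.contract_one_mu2, ih]

lemma contract_gen_coprod (hE : DualForm A mu2 Δ E) (i : I) (x : WordSpace I) :
    contract A (E (fg A i)) (Δ (evalW (fg A) x)) =
      ((1 : 𝕂) - qd A i ^ 2)⁻¹ • evalW (fg A) (lder A i x) := by
  refine word_ext_apply (contract A (E (fg A i)) ∘ₗ Δ ∘ₗ evalW (fg A))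
    (((1 : 𝕂) - qd A i ^ 2)⁻¹ • evalW (fg A) ∘ₗ lder A i) (fun w => ?_) x
  rw [LinearMap.comp_apply, LinearMap.comp_apply, LinearMap.smul_apply, LinearMap.comp_apply]
  induction w with
  | nil =>
    rw [evalW_nil, hE.coprod_one, contract_tmul, lder_nil, map_zero, smul_zero,
      ← evalW_nil (fg A), hE.gen_apply_of_ne (List.cons_ne_nil i []).symm, zero_smul]
  | cons j w ih =>
    rw [← lmulW_sg, evalW_lmulW, hE.coprod_mul, hE.contract_gen_mu2, ih, hE.contract_one_coprod,
      lder_lmulW, map_add, map_smul, evalW_lmulW, smul_add, mul_smul_comm,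
      smul_comm (((1 : 𝕂) - qd A i ^ 2)⁻¹)]
    congr 1
    split_ifs
    · rfl
    · rw [map_zero, smul_zero]

lemma word_apply (hE : DualForm A mu2 Δ E) (w : List I) (x : WordSpace I) :
    E (evalW (fg A) (sg w)) (evalW (fg A) x) =
      (w.map fun i => ((1 : 𝕂) - qd A i ^ 2)⁻¹).prod * wordPair A w x := by
  induction w generalizing x with
  | nil => rw [evalW_nil, hE.one_apply, wordPair_nil, List.map_nil, List.prod_nil, one_mul]
  | cons i w ih =>
    rw [← lmulW_sg, evalW_lmulW, hE.mul, pairT_eq_contract, hE.contract_gen_coprod, map_smul, ih,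
      wordPair_cons, List.map_cons, List.prod_cons, smul_eq_mul, mul_assoc]

end DualForm

/-- The scalar by which a word is rescaled under the map to level `m`. -/
def levScale (A : GCM I) (w : List I) : 𝕂 :=
  (w.map fun i => ((1 : 𝕂) - qd A i ^ 2)⁻¹ * sqv ^ A.d i).prod

lemma levScale_sq_mul_wordNorm (A : GCM I) (w : List I) :
    levScale A w * levScale A w * wordNorm A w =
      (w.map fun i => ((1 : 𝕂) - qd A i ^ 2)⁻¹).prod := by
  rw [levScale, wordNorm, ← List.prod_map_mul, ← List.prod_map_mul]
  congr 2
  funext i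
  have h1 := zi_ne_zero A i
  have h2 : sqv ^ A.d i ≠ 0 := zpow_ne_zero _ sqv_ne_zero
  rw [zpow_neg, two_mul, zpow_add₀ sqv_ne_zero]
  field_simp

lemma algHom_word (A : GCM I) (m : ℤ) (ψ : Uq A →ₐ[𝕂] hA A)
    (hψ : ∀ i, ψ (fg A i) = (((1 : 𝕂) - qd A i ^ 2)⁻¹ * sqv ^ A.d i) • ff A i m) (w : List I) :
    ψ (evalW (fg A) (sg w)) = levScale A w • lev A m (sg w) := by
  induction w with
  | nil => rw [evalW_nil, map_one, lev_nil, levScale, List.map_nil, List.prod_nil, one_smul]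
  | cons j w ih =>
    rw [← lmulW_sg, evalW_lmulW, lev_lmulW, map_mul, ih, hψ, smul_mul_smul_comm, levScale, levScale,
      List.map_cons, List.prod_cons]

lemma DualForm.eq_pair {A : GCM I}
    {mu2 : Uq A ⊗[𝕂] Uq A →ₗ[𝕂] Uq A ⊗[𝕂] Uq A →ₗ[𝕂] Uq A ⊗[𝕂] Uq A}
    {Δ : Uq A →ₗ[𝕂] Uq A ⊗[𝕂] Uq A} {E : Uq A →ₗ[𝕂] Uq A →ₗ[𝕂] 𝕂} (hE : DualForm A mu2 Δ E)
    {M : hA A →ₗ[𝕂] 𝕂} {Dm : hA A ≃ₐ[𝕂] hA A} {pairB : hA A →ₗ[𝕂] hA A →ₗ[𝕂] 𝕂}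
    (hB : BosonicForm A M Dm pairB) (m : ℤ) (ψ : Uq A →ₐ[𝕂] hA A)
    (hψ : ∀ i, ψ (fg A i) = (((1 : 𝕂) - qd A i ^ 2)⁻¹ * sqv ^ A.d i) • ff A i m) (u v : Uq A) :
    E u v = pairB (ψ u) (ψ v) := by
  obtain ⟨x, rfl⟩ := exists_evalW_fg A u
  obtain ⟨y, rfl⟩ := exists_evalW_fg A v
  refine word_ext_apply (E.flip (evalW (fg A) y) ∘ₗ evalW (fg A))
    (pairB.flip (ψ (evalW (fg A) y)) ∘ₗ ψ.toLinearMap ∘ₗ evalW (fg A)) (fun v => ?_) x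
  refine word_ext_apply (E (evalW (fg A) (sg v)) ∘ₗ evalW (fg A))
    (pairB (ψ (evalW (fg A) (sg v))) ∘ₗ ψ.toLinearMap ∘ₗ evalW (fg A)) (fun w => ?_) y
  change E (evalW (fg A) (sg v)) (evalW (fg A) (sg w)) =
    pairB (ψ (evalW (fg A) (sg v))) (ψ (evalW (fg A) (sg w)))
  rw [hE.word_apply, algHom_word A m ψ hψ, algHom_word A m ψ hψ, map_smul, map_smul,
    LinearMap.smul_apply, hB.pair_lev_word, smul_eq_mul, smul_eq_mul, wordPair_symm A w v]
  by_cases hvw : wordWt v = wordWt w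
  · have hp := perm_of_wordWt_eq hvw
    rw [← levScale_sq_mul_wordNorm, show levScale A w = levScale A v from (hp.symm.map _).prod_eq,
      show wordNorm A w = wordNorm A v from (hp.symm.map _).prod_eq]
    ring
  · rw [wordPair_eq_zero A hvw]
    ring

/-- the bilinear form `⟪·,·⟫` on `Â` satisfies:
(i) it is symmetric and non-degenerate;
(ii) for ordered products `x = x_b ⋯ x_a`, `y = y_b ⋯ y_a` with `x_k, y_k ∈ Â[k]`,
`⟪x,y⟫ = Π_k ⟪x_k, y_k⟫`;
(iii) `(x,y)_A = ⟪φ_m(x), φ_m(y)⟫` for all `x, y ∈ A_q(n)` and `m ∈ ℤ`.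
Here `⟪·,·⟫` is the bilinear form `pairB`, characterized on homogeneous elements by
`⟪x,y⟫ = q^{-N(wt x)} ⟨⟨x,y⟩⟩ = (q^{1/2})^{-(wt x,wt x)} M(x 𝒟̄(y))`; the coordinate ring
`(Aq, ev, ι)` with `(f,g)_A = ⟨f, ι⁻¹ g⟩ = ev f (ι.symm g)` is characterized as in the
context; and `φ_m : A_q(n) → Â[m] ⊆ Â` is the algebra homomorphism with
`φ_m(⟨i⟩) = q_i^{1/2} f_{i,m}`, i.e. `φ_m(ι(f_i)) = (1-q_i²)^{-1} q_i^{1/2} f_{i,m}`. -/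
theorem statement17 (A : GCM I)
    (M : hA A →ₗ[𝕂] 𝕂)
    (hMone : M 1 = 1)
    (hMzero : ∀ (m : ℤ) (β : I →₀ ℤ), β ≠ 0 → ∀ y, y ∈ hAk A m → y ∈ hAwt A β →
      ∀ u ∈ hAgt A m, ∀ v ∈ hAlt A m, M (u * y * v) = 0)
    (Dm : hA A ≃ₐ[𝕂] hA A)
    (hD : ∀ i p, Dm (ff A i p) = ff A i (p + 1))
    -- the normalized bilinear form `⟪·,·⟫`
    (pairB : hA A →ₗ[𝕂] hA A →ₗ[𝕂] 𝕂)
    (hpairB : ∀ (β : I →₀ ℤ) (x y : hA A), x ∈ hAwt A β →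
      pairB x y = sqv ^ (-(ip A β β)) * M (x * Dm y))
    -- the twisted multiplication and coproduct on `U`
    (mu2 : Uq A ⊗[𝕂] Uq A →ₗ[𝕂] Uq A ⊗[𝕂] Uq A →ₗ[𝕂] Uq A ⊗[𝕂] Uq A)
    (hmu2 : ∀ β' γ x y x' y', x' ∈ Uwt A β' → y ∈ Uwt A γ →
      mu2 (x ⊗ₜ[𝕂] y) (x' ⊗ₜ[𝕂] y') = qh ^ (-(ip A β' γ)) • ((x * x') ⊗ₜ[𝕂] (y * y')))
    (Δ : Uq A →ₗ[𝕂] Uq A ⊗[𝕂] Uq A)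
    (hΔone : Δ 1 = 1 ⊗ₜ[𝕂] 1)
    (hΔf : ∀ i, Δ (fg A i) = fg A i ⊗ₜ[𝕂] 1 + 1 ⊗ₜ[𝕂] fg A i)
    (hΔmul : ∀ x y, Δ (x * y) = mu2 (Δ x) (Δ y))
    -- the quantum unipotent coordinate ring
    {Aq : Type} [Ring Aq] [Algebra 𝕂 Aq]
    (ev : Aq →ₗ[𝕂] Uq A →ₗ[𝕂] 𝕂)
    (ι : Uq A ≃ₐ[𝕂] Aq)
    (hι : ∀ i j, ev (ι (fg A i)) (fg A j) =
      if i = j then ((1 : 𝕂) - qd A i ^ 2)⁻¹ else 0)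
    (hevone : ev (ι 1) 1 = 1)
    (hevmul : ∀ (x y : Aq) (u : Uq A), ev (x * y) u = pairT A (ev x) (ev y) (Δ u))
    (hevwt : ∀ β γ u v, β ≠ γ → u ∈ Uwt A β → v ∈ Uwt A γ → ev (ι u) v = 0)
    -- the maps `φ_m : A_q(n) → Â[m]`
    (φ : ℤ → (Aq →ₐ[𝕂] hA A))
    (hφ : ∀ (m : ℤ) (i : I),
      (φ m) (ι (fg A i)) = (((1 : 𝕂) - qd A i ^ 2)⁻¹ * sqv ^ A.d i) • ff A i m) :
    (∀ x y : hA A, pairB x y = pairB y x) ∧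
    (∀ x : hA A, (∀ y : hA A, pairB x y = 0) → x = 0) ∧
    (∀ (a b : ℤ) (xs ys : Fin (b + 1 - a).toNat → hA A),
      (∀ k : Fin (b + 1 - a).toNat, xs k ∈ hAk A (b - (k : ℕ))) →
      (∀ k : Fin (b + 1 - a).toNat, ys k ∈ hAk A (b - (k : ℕ))) →
      pairB (List.ofFn xs).prod (List.ofFn ys).prod =
        ∏ k : Fin (b + 1 - a).toNat, pairB (xs k) (ys k)) ∧
    (∀ (x y : Aq) (m : ℤ), ev x (ι.symm y) = pairB ((φ m) x) ((φ m) y)) := by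
  have hB : BosonicForm A M Dm pairB := ⟨hMone, hMzero, hD, hpairB⟩
  have hE : DualForm A mu2 Δ (ev ∘ₗ ι.toAlgHom.toLinearMap) :=
    ⟨hmu2, hΔone, hΔf, hΔmul, hι, hevone, fun x y u => by
      simp only [LinearMap.comp_apply, AlgHom.toLinearMap_apply, map_mul, hevmul], hevwt⟩
  refine ⟨hB.pair_symm, fun x => hB.eq_zero_of_pair, fun a b xs ys hx hy =>
    hB.pair_ofFn_prod xs ys hx hy, fun x y m => ?_⟩
  have h := hE.eq_pair hB m ((φ m).comp ι.toAlgHom) (hφ m) (ι.symm x) (ι.symm y)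
  simpa using h

end
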